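/- arXiv:2008.00677 — 2 statements merged into one kernel-verified Lean document; each statement's English description precedes it below -/
import Mathlib

section
/- For every dimension n ≥ 2 and constants c, C > 0 there exists a constant c' > 0 (depending only on n, c, C) with the following property. Let λ > 2, r > 0, x₀ ∈ ℝⁿ, and let u be a λ-eigenfunction on the ball B(x₀, 2r) which satisfies the Remez-type inequality: for every ball B ⊆ B(x₀, 2r) and every measurable set E ⊆ B with |E| > 0 one has sup_E |u| ≥ c·(c·|E|/|B|)^{C√λ}·sup_B |u|. Then every connected component Ω of the set {x ∈ B(x₀, 2r) : u(x) ≠ 0} that intersects B(x₀, r) satisfies |Ω| ≥ c'·min( λ^{-n/2}, rⁿ/(√λ·log λ)^{n-1} ). -/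
open MeasureTheory Metric Set

/-- The Euclidean Laplacian `Δu = ∑ⱼ ∂²u/∂xⱼ²` of `u : ℝⁿ → ℝ`. -/
noncomputable def lapl (n : ℕ) (u : EuclideanSpace ℝ (Fin n) → ℝ)
    (x : EuclideanSpace ℝ (Fin n)) : ℝ :=
  ∑ j : Fin n,
    fderiv ℝ (fun y => fderiv ℝ u y (EuclideanSpace.single j (1:ℝ))) x
      (EuclideanSpace.single j (1:ℝ))

section IndicatorSmooth

variable {E F : Type*} [NormedAddCommGroup E] [NormedSpace ℝ E] [NormedAddCommGroup F]
  [NormedSpace ℝ F]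

/-- A function whose value and derivative vanish on the frontier of an open set can be cut off
to that set without losing differentiability. -/
lemma hasFDerivAt_indicator {D : Set E} (hD : IsOpen D) {h : E → F} (hh : Differentiable ℝ h)
    (h0 : ∀ y ∈ frontier D, h y = 0) (h1 : ∀ y ∈ frontier D, fderiv ℝ h y = 0) (y : E) :
    HasFDerivAt (D.indicator h) (D.indicator (fderiv ℝ h) y) y := by
  by_cases hy : y ∈ D
  · rw [indicator_of_mem hy]
    refine (hh y).hasFDerivAt.congr_of_eventuallyEq ?_
    filter_upwards [hD.mem_nhds hy] with z hz
    exact indicator_of_mem hz h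
  · rw [indicator_of_notMem hy]
    by_cases hc : y ∈ closure D
    · have hf : y ∈ frontier D := by rw [hD.frontier_eq]; exact ⟨hc, hy⟩
      have hder : HasFDerivAt h (0 : E →L[ℝ] F) y := h1 y hf ▸ (hh y).hasFDerivAt
      rw [hasFDerivAt_iff_isLittleO] at hder ⊢
      refine (Asymptotics.IsBigO.of_bound 1
        (Filter.Eventually.of_forall fun z => ?_)).trans_isLittleO hder
      rw [indicator_of_notMem hy, h0 y hf]
      simpa using norm_indicator_le_norm_self h z
    · refine (hasFDerivAt_const (0 : F) y).congr_of_eventuallyEq ?_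
      filter_upwards [isClosed_closure.isOpen_compl.mem_nhds hc] with z hz
      exact indicator_of_notMem (fun hzD => hz (subset_closure hzD)) h

lemma fderiv_indicator {D : Set E} (hD : IsOpen D) {h : E → F} (hh : Differentiable ℝ h)
    (h0 : ∀ y ∈ frontier D, h y = 0) (h1 : ∀ y ∈ frontier D, fderiv ℝ h y = 0) :
    fderiv ℝ (D.indicator h) = D.indicator (fderiv ℝ h) :=
  funext fun y => (hasFDerivAt_indicator hD hh h0 h1 y).fderiv

lemma fderiv_pow_three {f : E → ℝ} (hf : Differentiable ℝ f) :
    fderiv ℝ (fun y => f y ^ 3) = fun y => (3 * f y ^ 2) • fderiv ℝ f y := by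
  ext1 y
  simpa using ((hf y).hasFDerivAt.pow 3).fderiv

lemma fderiv_fderiv_pow_three {f : E → ℝ} (hf : ContDiff ℝ 2 f) (y : E) :
    HasFDerivAt (fun y => (3 * f y ^ 2) • fderiv ℝ f y)
      ((3 * f y ^ 2) • fderiv ℝ (fderiv ℝ f) y +
        ((6 * f y) • fderiv ℝ f y).smulRight (fderiv ℝ f y)) y := by
  have hd : Differentiable ℝ f := hf.differentiable (by norm_num)
  have hd2 : Differentiable ℝ (fderiv ℝ f) :=
    (hf.fderiv_right (m := 1) (by norm_num)).differentiable (by norm_num)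
  have := (((hd y).hasFDerivAt.pow 2).const_mul 3).smul (hd2 y).hasFDerivAt
  refine HasFDerivAt.congr_fderiv this ?_
  ext v z
  simp
  exact Or.inl (by ring)

lemma contDiff_indicator_pow_three {D : Set E} (hD : IsOpen D) {f : E → ℝ} (hf : ContDiff ℝ 2 f)
    (h0 : ∀ y ∈ frontier D, f y = 0) :
    ContDiff ℝ 2 (D.indicator fun y => f y ^ 3) ∧
      ∀ y, fderiv ℝ (fderiv ℝ (D.indicator fun y => f y ^ 3)) y = D.indicator (fun y =>
        (3 * f y ^ 2) • fderiv ℝ (fderiv ℝ f) y +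
        ((6 * f y) • fderiv ℝ f y).smulRight (fderiv ℝ f y)) y := by
  have hd : Differentiable ℝ f := hf.differentiable (by norm_num)
  have hc3 : ContDiff ℝ 2 (fun y => f y ^ 3) := hf.pow 3
  have hd3 : Differentiable ℝ (fun y => f y ^ 3) := hc3.differentiable (by norm_num)
  have hd32 : ContDiff ℝ 1 (fderiv ℝ (fun y => f y ^ 3)) :=
    hc3.fderiv_right (m := 1) (by norm_num)
  have e1 : ∀ y ∈ frontier D, f y ^ 3 = 0 := fun y hy => by simp [h0 y hy]
  have e2 : ∀ y ∈ frontier D, fderiv ℝ (fun y => f y ^ 3) y = 0 := fun y hy => by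
    rw [fderiv_pow_three hd]; simp [h0 y hy]
  have hF : fderiv ℝ (fderiv ℝ (fun y => f y ^ 3)) = fun y =>
        (3 * f y ^ 2) • fderiv ℝ (fderiv ℝ f) y +
        ((6 * f y) • fderiv ℝ f y).smulRight (fderiv ℝ f y) := by
    rw [fderiv_pow_three hd]
    exact funext fun y => (fderiv_fderiv_pow_three hf y).fderiv
  have e3 : ∀ y ∈ frontier D, fderiv ℝ (fderiv ℝ (fun y => f y ^ 3)) y = 0 := fun y hy => by
    rw [hF]; ext; simp [h0 y hy]
  have hw1 := hasFDerivAt_indicator hD hd3 e1 e2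
  have hw2 := hasFDerivAt_indicator hD (hd32.differentiable (by norm_num)) e2 e3
  refine ⟨?_, ?_⟩
  · rw [show (2 : WithTop ℕ∞) = 1 + 1 by norm_num, contDiff_succ_iff_fderiv]
    refine ⟨fun y => (hw1 y).differentiableAt, by simp, ?_⟩
    rw [fderiv_indicator hD hd3 e1 e2, contDiff_one_iff_fderiv]
    refine ⟨fun y => (hw2 y).differentiableAt, ?_⟩
    rw [fderiv_indicator hD (hd32.differentiable (by norm_num)) e2 e3]
    exact (hd32.continuous_fderiv (by norm_num)).indicator e3
  · intro y
    rw [fderiv_indicator hD hd3 e1 e2,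
      fderiv_indicator hD (hd32.differentiable (by norm_num)) e2 e3, hF]

end IndicatorSmooth

lemma lapl_eq_sum_fderiv_fderiv {n : ℕ} {w : EuclideanSpace ℝ (Fin n) → ℝ} (hw : ContDiff ℝ 2 w)
    (x : EuclideanSpace ℝ (Fin n)) :
    lapl n w x = ∑ j : Fin n, fderiv ℝ (fderiv ℝ w) x (EuclideanSpace.single j (1 : ℝ))
      (EuclideanSpace.single j (1 : ℝ)) := by
  have hd : DifferentiableAt ℝ (fderiv ℝ w) x :=
    (hw.fderiv_right (m := 1) (by norm_num)).differentiable (by norm_num) x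
  refine Finset.sum_congr rfl fun j _ => ?_
  have := (hd.hasFDerivAt.clm_apply
    (hasFDerivAt_const (EuclideanSpace.single j (1 : ℝ)) x)).fderiv
  rw [this]
  simp

lemma lapl_indicator_pow_three_ge {n : ℕ} {D : Set (EuclideanSpace ℝ (Fin n))} (hD : IsOpen D)
    {f : EuclideanSpace ℝ (Fin n) → ℝ} (hf : ContDiff ℝ 2 f) (h0 : ∀ y ∈ frontier D, f y = 0)
    (hpos : ∀ y ∈ D, 0 ≤ f y) (x : EuclideanSpace ℝ (Fin n)) :
    D.indicator (fun y => 3 * f y ^ 2 * lapl n f y) x ≤ lapl n (D.indicator fun y => f y ^ 3) x := by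
  obtain ⟨hc, hF⟩ := contDiff_indicator_pow_three hD hf h0
  rw [lapl_eq_sum_fderiv_fderiv hc, hF]
  by_cases hx : x ∈ D
  · simp only [indicator_of_mem hx, lapl_eq_sum_fderiv_fderiv hf, Finset.mul_sum]
    refine Finset.sum_le_sum fun j _ => ?_
    have := hpos x hx
    simp only [add_apply, smul_apply, smul_eq_mul,
      ContinuousLinearMap.smulRight_apply, le_add_iff_nonneg_right]
    have h2 := mul_self_nonneg (fderiv ℝ f x (EuclideanSpace.single j (1 : ℝ)))
    nlinarith [mul_nonneg this h2]
  · simp [hx]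

/-- The Laplacian of `u² - a - b|y - z|²`. -/
lemma lapl_sq_sub_ge {n : ℕ} {u : EuclideanSpace ℝ (Fin n) → ℝ} (hu : ContDiff ℝ 2 u) (a b : ℝ)
    (z x : EuclideanSpace ℝ (Fin n)) :
    2 * u x * lapl n u x - 2 * n * b ≤ lapl n (fun y => u y ^ 2 - a - b * ‖y - z‖ ^ 2) x := by
  have hd : Differentiable ℝ u := hu.differentiable (by norm_num)
  have hd2 : Differentiable ℝ (fderiv ℝ u) :=
    (hu.fderiv_right (m := 1) (by norm_num)).differentiable (by norm_num)
  have h1 : ∀ y v, fderiv ℝ (fun y => u y ^ 2 - a - b * ‖y - z‖ ^ 2) y v =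
      2 * (u y * fderiv ℝ u y v) - 2 * b * inner ℝ (y - z) v := by
    intro y v
    have := ((((hd y).hasFDerivAt.pow 2).sub_const a).sub
      ((((hasFDerivAt_id y).sub_const z).norm_sq).const_mul b)).fderiv
    refine (congrArg (fun L => L v) this).trans ?_
    simp [inner_sub_left]
    ring
  have h2 : ∀ v, fderiv ℝ (fun y => fderiv ℝ (fun y => u y ^ 2 - a - b * ‖y - z‖ ^ 2) y v) x v =
      2 * (u x * fderiv ℝ (fun y => fderiv ℝ u y v) x v + (fderiv ℝ u x v) ^ 2) -
        2 * b * inner ℝ v v := by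
    intro v
    simp only [h1]
    have hv : DifferentiableAt ℝ (fun y => fderiv ℝ u y v) x :=
      (hd2 x).clm_apply (differentiableAt_const v)
    have := ((((hd x).hasFDerivAt.mul hv.hasFDerivAt).const_mul 2).sub
      ((((hasFDerivAt_id x).sub_const z).inner ℝ (hasFDerivAt_const v x)).const_mul (2 * b))).fderiv
    refine (congrArg (fun L => L v) this).trans ?_
    simp
    ring
  unfold lapl
  simp only [h2]
  rw [Finset.mul_sum, show (2 * n * b : ℝ) = ∑ j : Fin n, 2 * b by simp; ring,
    ← Finset.sum_sub_distrib]
  refine Finset.sum_le_sum fun j _ => ?_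
  rw [real_inner_self_eq_norm_sq]
  simp
  nlinarith [sq_nonneg (fderiv ℝ u x (EuclideanSpace.single j 1))]

section MeanValue

variable {n : ℕ}

/-- The radial weight `4(1 - |y|²)₊`. -/
noncomputable def weightG (n : ℕ) : EuclideanSpace ℝ (Fin n) → ℝ :=
  (ball 0 1).indicator fun y => 4 * (1 - ‖y‖ ^ 2)

/-- The radial weight `(1 - |y|²)₊²`, whose gradient is `-y` times `weightG`. -/
noncomputable def weightH (n : ℕ) : EuclideanSpace ℝ (Fin n) → ℝ :=
  (ball 0 1).indicator fun y => (1 - ‖y‖ ^ 2) ^ 2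

lemma norm_eq_one_of_mem_frontier {y : EuclideanSpace ℝ (Fin n)}
    (hy : y ∈ frontier (ball (0 : EuclideanSpace ℝ (Fin n)) 1)) : ‖y‖ = 1 := by
  simpa using frontier_ball_subset_sphere hy

lemma continuous_weightG : Continuous (weightG n) :=
  Continuous.indicator (fun y hy => by simp [norm_eq_one_of_mem_frontier hy]) (by fun_prop)

lemma hasFDerivAt_one_sub_sq (y : EuclideanSpace ℝ (Fin n)) :
    HasFDerivAt (fun y : EuclideanSpace ℝ (Fin n) => (1 - ‖y‖ ^ 2) ^ 2)
      ((-(4 * (1 - ‖y‖ ^ 2))) • innerSL ℝ y) y := by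
  have := (((hasFDerivAt_id y).norm_sq).const_sub 1).pow 2
  refine HasFDerivAt.congr_fderiv this ?_
  ext v
  simp
  ring

lemma hasFDerivAt_weightH (y : EuclideanSpace ℝ (Fin n)) :
    HasFDerivAt (weightH n) (-weightG n y • innerSL ℝ y) y := by
  have h := hasFDerivAt_indicator (D := ball (0 : EuclideanSpace ℝ (Fin n)) 1) isOpen_ball
    (h := fun y => (1 - ‖y‖ ^ 2) ^ 2) (fun y => (hasFDerivAt_one_sub_sq y).differentiableAt)
    (fun y hy => by simp [norm_eq_one_of_mem_frontier hy])
    (fun y hy => by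
      rw [(hasFDerivAt_one_sub_sq y).fderiv]; simp [norm_eq_one_of_mem_frontier hy]) y
  refine HasFDerivAt.congr_fderiv h ?_
  by_cases hy : y ∈ ball (0 : EuclideanSpace ℝ (Fin n)) 1
  · simp only [weightG, indicator_of_mem hy, (hasFDerivAt_one_sub_sq y).fderiv]
  · simp only [weightG, indicator_of_notMem hy, neg_zero, zero_smul]

lemma continuous_weightH : Continuous (weightH n) :=
  continuous_iff_continuousAt.2 fun y => (hasFDerivAt_weightH y).continuousAt

lemma one_sub_sq_pos {y : EuclideanSpace ℝ (Fin n)} (hy : y ∈ ball 0 1) : 0 < 1 - ‖y‖ ^ 2 := by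
  have : ‖y‖ < 1 := by simpa using hy
  nlinarith [norm_nonneg y]

lemma weightG_nonneg (y : EuclideanSpace ℝ (Fin n)) : 0 ≤ weightG n y :=
  indicator_nonneg (fun y hy => by have := one_sub_sq_pos hy; positivity) y

lemma weightG_le (y : EuclideanSpace ℝ (Fin n)) : weightG n y ≤ 4 := by
  refine indicator_le' (g := fun _ => (4 : ℝ)) (fun y _ => ?_) (fun _ _ => by norm_num) y
  nlinarith [sq_nonneg ‖y‖]

lemma weightH_nonneg (y : EuclideanSpace ℝ (Fin n)) : 0 ≤ weightH n y :=
  indicator_nonneg (fun y _ => by positivity) y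

lemma hasCompactSupport_indicator_ball (f : EuclideanSpace ℝ (Fin n) → ℝ) :
    HasCompactSupport ((ball 0 1).indicator f) :=
  HasCompactSupport.intro (isCompact_closedBall 0 1) fun _ hy =>
    indicator_of_notMem (fun h => hy (ball_subset_closedBall h)) f

lemma integral_weightG_pos : 0 < ∫ y, weightG n y :=
  continuous_weightG.integral_pos_of_hasCompactSupport_nonneg_nonzero
    (hasCompactSupport_indicator_ball _) weightG_nonneg (x := 0) (by simp [weightG])

lemma integral_weightH_nonneg : 0 ≤ ∫ y, weightH n y := integral_nonneg weightH_nonneg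

lemma integrable_mul_weightG {f : EuclideanSpace ℝ (Fin n) → ℝ} (hf : Continuous f) :
    Integrable fun y => f y * weightG n y :=
  (hf.mul continuous_weightG).integrable_of_hasCompactSupport
    (hasCompactSupport_indicator_ball _).mul_left

lemma integrable_mul_weightH {f : EuclideanSpace ℝ (Fin n) → ℝ} (hf : Continuous f) :
    Integrable fun y => f y * weightH n y :=
  (hf.mul continuous_weightH).integrable_of_hasCompactSupport
    (hasCompactSupport_indicator_ball _).mul_left

lemma continuous_lapl {w : EuclideanSpace ℝ (Fin n) → ℝ} (hw : ContDiff ℝ 2 w) :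
    Continuous (lapl n w) := by
  have hc : Continuous (fderiv ℝ (fderiv ℝ w)) :=
    (hw.fderiv_right (m := 1) (by norm_num)).continuous_fderiv (by norm_num)
  rw [funext (lapl_eq_sum_fderiv_fderiv hw)]
  fun_prop

lemma integral_radial_deriv {w : EuclideanSpace ℝ (Fin n) → ℝ} (hw : ContDiff ℝ 2 w)
    (x : EuclideanSpace ℝ (Fin n)) (τ : ℝ) :
    ∫ y, fderiv ℝ w (x + τ • y) y * weightG n y =
      τ * ∫ y, lapl n w (x + τ • y) * weightH n y := by
  have hc1 : ContDiff ℝ 1 (fderiv ℝ w) := hw.fderiv_right (m := 1) (by norm_num)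
  have hc : Continuous (fderiv ℝ w) := hc1.continuous
  have hc2 : Continuous (fderiv ℝ (fderiv ℝ w)) := hc1.continuous_fderiv (by norm_num)
  set e : Fin n → EuclideanSpace ℝ (Fin n) := fun j => EuclideanSpace.single j (1 : ℝ) with he
  have hD : ∀ j y, HasFDerivAt (fun y => fderiv ℝ w (x + τ • y) (e j))
      ((τ • fderiv ℝ (fderiv ℝ w) (x + τ • y)).flip (e j)) y := by
    intro j y
    have h1 : HasFDerivAt (fun y : EuclideanSpace ℝ (Fin n) => x + τ • y)
        (τ • ContinuousLinearMap.id ℝ _) y := ((hasFDerivAt_id y).const_smul τ).const_add x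
    have h2 := ((hc1.differentiable (by norm_num) (x + τ • y)).hasFDerivAt.comp y h1).clm_apply
      (hasFDerivAt_const (e j) y)
    refine HasFDerivAt.congr_fderiv h2 ?_
    ext v
    simp
  have hfd : ∀ j y, fderiv ℝ (weightH n) y (e j) = -(weightG n y * y j) := by
    intro j y
    rw [(hasFDerivAt_weightH y).fderiv]
    simp [he, EuclideanSpace.inner_single_right]
  have hparts : ∀ j, ∫ y, fderiv ℝ w (x + τ • y) (e j) * (y j * weightG n y) =
      τ * ∫ y, fderiv ℝ (fderiv ℝ w) (x + τ • y) (e j) (e j) * weightH n y := by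
    intro j
    have hfj : ∀ y, fderiv ℝ (fun y => fderiv ℝ w (x + τ • y) (e j)) y (e j) =
        τ * fderiv ℝ (fderiv ℝ w) (x + τ • y) (e j) (e j) := by
      intro y
      rw [(hD j y).fderiv]
      simp
    have hpart := integral_mul_fderiv_eq_neg_fderiv_mul_of_integrable
      (μ := (volume : Measure (EuclideanSpace ℝ (Fin n))))
      (f := fun y => fderiv ℝ w (x + τ • y) (e j)) (g := weightH n) (v := e j)
      (by simp only [hfj]; exact integrable_mul_weightH (by fun_prop))
      (by
        simp only [hfd]
        have := (integrable_mul_weightG (n := n)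
          (f := fun y => fderiv ℝ w (x + τ • y) (e j) * y j) (by fun_prop)).neg
        refine this.congr (Filter.Eventually.of_forall fun y => ?_)
        simp only [Pi.neg_apply]
        ring)
      (integrable_mul_weightH (by fun_prop))
      (fun y _ => (hD j y).differentiableAt) (fun y _ => (hasFDerivAt_weightH y).differentiableAt)
    simp only [hfj, hfd, mul_assoc, integral_const_mul] at hpart
    rw [← neg_inj, ← hpart, ← integral_neg]
    congr 1 with y
    ring
  have hsum : ∀ y, fderiv ℝ w (x + τ • y) y * weightG n y =
      ∑ j, fderiv ℝ w (x + τ • y) (e j) * (y j * weightG n y) := by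
    intro y
    have hy : y = ∑ j, y j • e j := by
      ext i
      simp [he, Finset.sum_apply, Pi.single_apply]
    conv_lhs => rw [show fderiv ℝ w (x + τ • y) y = fderiv ℝ w (x + τ • y) (∑ j, y j • e j) by
      rw [← hy]]
    rw [map_sum, Finset.sum_mul]
    refine Finset.sum_congr rfl fun j _ => ?_
    rw [map_smul, smul_eq_mul]
    ring
  simp only [hsum, lapl_eq_sum_fderiv_fderiv hw, Finset.sum_mul]
  rw [integral_finsetSum, integral_finsetSum, Finset.mul_sum]
  · exact Finset.sum_congr rfl fun j _ => hparts j
  · exact fun j _ => integrable_mul_weightH (by fun_prop)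
  · intro j _
    simp only [← mul_assoc]
    exact integrable_mul_weightG (by fun_prop)

lemma hasDerivAt_integral_weightG {w : EuclideanSpace ℝ (Fin n) → ℝ} (hw : ContDiff ℝ 2 w)
    (x : EuclideanSpace ℝ (Fin n)) (τ : ℝ) :
    HasDerivAt (fun τ => ∫ y, w (x + τ • y) * weightG n y)
      (∫ y, fderiv ℝ w (x + τ • y) y * weightG n y) τ := by
  have hc : Continuous (fderiv ℝ w) := hw.continuous_fderiv (by norm_num)
  have hcG := continuous_weightG (n := n)
  have hcw := hw.continuous
  have hcont : Continuous fun p : ℝ × EuclideanSpace ℝ (Fin n) =>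
      fderiv ℝ w (x + p.1 • p.2) p.2 * weightG n p.2 := by fun_prop
  obtain ⟨K, hK⟩ := ((isCompact_closedBall τ 1).prod
    (isCompact_closedBall (0 : EuclideanSpace ℝ (Fin n)) 1)).exists_bound_of_continuousOn
      hcont.continuousOn
  refine (hasDerivAt_integral_of_dominated_loc_of_deriv_le (closedBall_mem_nhds τ one_pos)
    (F' := fun τ y => fderiv ℝ w (x + τ • y) y * weightG n y)
    (bound := (closedBall (0 : EuclideanSpace ℝ (Fin n)) 1).indicator fun _ => K)
    (Filter.Eventually.of_forall fun t => ?_) ?_ ?_ ?_ ?_ ?_).2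
  · exact Continuous.aestronglyMeasurable (by fun_prop)
  · exact integrable_mul_weightG (by fun_prop)
  · exact Continuous.aestronglyMeasurable (by fun_prop)
  · refine Filter.Eventually.of_forall fun y t ht => ?_
    by_cases hy : y ∈ closedBall (0 : EuclideanSpace ℝ (Fin n)) 1
    · rw [indicator_of_mem hy]
      exact hK (t, y) ⟨ht, hy⟩
    · rw [indicator_of_notMem hy, weightG,
        indicator_of_notMem (fun h => hy (ball_subset_closedBall h))]
      simp
  · exact (integrable_indicator_iff measurableSet_closedBall).2
      (integrableOn_const (isCompact_closedBall _ _).measure_lt_top.ne)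
  · refine Filter.Eventually.of_forall fun y t _ => ?_
    have h1 : HasDerivAt (fun t : ℝ => x + t • y) y t := by
      simpa using ((hasDerivAt_id t).smul_const y).const_add x
    exact (((hw.differentiable (by norm_num) (x + t • y)).hasFDerivAt.comp_hasDerivAt t
      h1)).mul_const (weightG n y)

/-- Weighted sub-mean value inequality for functions with Laplacian bounded below. -/
lemma mul_integral_weightG_le {w : EuclideanSpace ℝ (Fin n) → ℝ} (hw : ContDiff ℝ 2 w) {Λ : ℝ}
    (hΛ : ∀ y, -Λ ≤ lapl n w y) (x : EuclideanSpace ℝ (Fin n)) {s : ℝ} (hs : 0 ≤ s) :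
    w x * ∫ y, weightG n y ≤
      (∫ y, w (x + s • y) * weightG n y) + Λ * s ^ 2 / 2 * ∫ y, weightH n y := by
  set F : ℝ → ℝ := fun τ => (∫ y, w (x + τ • y) * weightG n y) +
    (τ ^ 2 / 2) * (Λ * ∫ y, weightH n y) with hF
  have hder : ∀ τ, HasDerivAt F (τ * (∫ y, lapl n w (x + τ • y) * weightH n y) +
      τ * (Λ * ∫ y, weightH n y)) τ := by
    intro τ
    have h1 := hasDerivAt_integral_weightG hw x τ
    rw [integral_radial_deriv hw] at h1
    have h2 : HasDerivAt (fun τ : ℝ => τ ^ 2 / 2) τ τ := by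
      have := ((hasDerivAt_id τ).pow 2).div_const 2
      simpa using this
    exact h1.add (h2.mul_const _)
  have hmono : MonotoneOn F (Ici 0) := by
    refine monotoneOn_of_deriv_nonneg (convex_Ici 0)
      (fun τ _ => (hder τ).continuousAt.continuousWithinAt)
      (fun τ _ => (hder τ).differentiableAt.differentiableWithinAt) fun τ hτ => ?_
    rw [interior_Ici] at hτ
    rw [(hder τ).deriv, ← mul_add]
    refine mul_nonneg (le_of_lt hτ) ?_
    have hcl := continuous_lapl hw
    rw [← integral_const_mul, ← integral_add (integrable_mul_weightH (by fun_prop))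
      (integrable_mul_weightH continuous_const)]
    refine integral_nonneg fun y => ?_
    have := mul_le_mul_of_nonneg_right (hΛ (x + τ • y)) (weightH_nonneg y)
    simp only [Pi.zero_apply]
    linarith
  have := hmono (mem_Ici.2 le_rfl) (mem_Ici.2 hs) hs
  simp only [hF, zero_smul, add_zero, integral_const_mul] at this
  linarith

end MeanValue

section Decay

variable {n : ℕ}

lemma measureReal_preimage_affine (x : EuclideanSpace ℝ (Fin n)) {σ : ℝ} (hσ : 0 < σ)
    (T : Set (EuclideanSpace ℝ (Fin n))) :
    volume.real {y : EuclideanSpace ℝ (Fin n) | x + σ • y ∈ T} = volume.real T / σ ^ n := by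
  have h1 : {y : EuclideanSpace ℝ (Fin n) | x + σ • y ∈ T} = (σ • ·) ⁻¹' ((x + ·) ⁻¹' T) := rfl
  rw [h1, measureReal_def, Measure.addHaar_preimage_smul _ hσ.ne', measure_preimage_add,
    finrank_euclideanSpace_fin, ENNReal.toReal_mul, ENNReal.toReal_ofReal (abs_nonneg _),
    abs_of_pos (by positivity), measureReal_def, div_eq_inv_mul]

/-- The weighted mean of a function bounded by `M` and supported in `D` is controlled by the
volume of `D`. -/
lemma integral_mul_weightG_le {D : Set (EuclideanSpace ℝ (Fin n))} (hD : IsOpen D)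
    {w : EuclideanSpace ℝ (Fin n) → ℝ} (hw : Continuous w) {M : ℝ} (hM : 0 ≤ M)
    (hwM : ∀ y, w y ≤ D.indicator (fun _ => M) y) (x : EuclideanSpace ℝ (Fin n)) {σ : ℝ}
    (hσ : 0 < σ) :
    ∫ y, w (x + σ • y) * weightG n y ≤ 4 * M * (volume.real (D ∩ ball x σ) / σ ^ n) := by
  set T : Set (EuclideanSpace ℝ (Fin n)) := {y | x + σ • y ∈ D ∩ ball x σ} with hT
  have hTo : IsOpen T := (hD.inter isOpen_ball).preimage (by fun_prop)
  have hTsub : T ⊆ ball 0 1 := by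
    intro y hy
    have h2 := hy.2
    simp only [mem_ball, dist_self_add_left, norm_smul, Real.norm_eq_abs, abs_of_pos hσ] at h2
    have : ‖y‖ < 1 := by nlinarith
    simpa using this
  have hTfin : volume T ≠ ⊤ := ((measure_mono hTsub).trans_lt measure_ball_lt_top).ne
  have hint : Integrable (T.indicator fun _ => 4 * M) volume :=
    (integrable_indicator_iff hTo.measurableSet).2 (integrableOn_const hTfin)
  have hle : ∫ y, w (x + σ • y) * weightG n y ≤ ∫ y, T.indicator (fun _ => 4 * M) y := by
    refine integral_mono (integrable_mul_weightG (by fun_prop)) hint fun y => ?_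
    have hG := weightG_nonneg y
    have hG4 := weightG_le y
    have hwy := hwM (x + σ • y)
    by_cases hy : y ∈ T
    · rw [indicator_of_mem hy]
      rw [indicator_of_mem hy.1] at hwy
      calc w (x + σ • y) * weightG n y ≤ M * weightG n y := by gcongr
        _ ≤ 4 * M := by nlinarith
    · rw [indicator_of_notMem hy]
      by_cases hyb : y ∈ ball (0 : EuclideanSpace ℝ (Fin n)) 1
      · have hnD : x + σ • y ∉ D := by
          refine fun hyD => hy ⟨hyD, ?_⟩
          have hyb' : ‖y‖ < 1 := by simpa using hyb
          simp only [mem_ball, dist_self_add_left, norm_smul, Real.norm_eq_abs, abs_of_pos hσ]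
          nlinarith
        rw [indicator_of_notMem hnD] at hwy
        exact mul_nonpos_of_nonpos_of_nonneg hwy hG
      · simp [weightG, indicator_of_notMem hyb]
  refine hle.trans (le_of_eq ?_)
  rw [integral_indicator hTo.measurableSet, setIntegral_const, hT,
    measureReal_preimage_affine x hσ, smul_eq_mul, mul_comm]

/-- A truncated eigenfunction whose support has small volume near `x` is small at `x`. -/
lemma exists_truncation_decay (n : ℕ) :
    ∃ η : ℝ, 0 < η ∧ ∀ (lam s S a b : ℝ) (u : EuclideanSpace ℝ (Fin n) → ℝ)
      (D : Set (EuclideanSpace ℝ (Fin n))) (z x : EuclideanSpace ℝ (Fin n)),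
      0 ≤ lam → 0 < s → lam * s ^ 2 ≤ 1 → 0 ≤ a → 0 ≤ b → b * s ^ 2 ≤ S ^ 2 →
      ContDiff ℝ 2 u → IsOpen D →
      (∀ y ∈ D, 0 ≤ u y ^ 2 - a - b * ‖y - z‖ ^ 2) →
      (∀ y ∈ frontier D, u y ^ 2 - a - b * ‖y - z‖ ^ 2 = 0) →
      (∀ y ∈ D, lapl n u y = -lam * u y) → (∀ y ∈ D, u y ^ 2 ≤ S ^ 2) →
      volume.real (D ∩ ball x s) ≤ η * s ^ n → x ∈ D →
      u x ^ 2 - a - b * ‖x - z‖ ^ 2 ≤ S ^ 2 / 8 := by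
  set IG := ∫ y, weightG n y with hIG
  set IH := ∫ y, weightH n y with hIH
  have hIGpos : 0 < IG := integral_weightG_pos
  have hIHnn : 0 ≤ IH := integral_weightH_nonneg
  obtain ⟨τ, hτ0, hτ1, hτ⟩ : ∃ τ : ℝ, 0 < τ ∧ τ ≤ 1 ∧ 3 * (1 + n) * IH * τ ^ 2 ≤ IG / 1024 := by
    set q := IG / 1024 / (3 * (1 + n) * IH + 1) with hq
    have hqpos : 0 < q := by positivity
    refine ⟨min 1 q, by positivity, min_le_left _ _, ?_⟩
    have h1 : (min 1 q) ^ 2 ≤ q := by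
      have h0 : 0 < min 1 q := by positivity
      nlinarith [min_le_left 1 q, min_le_right 1 q]
    calc 3 * (1 + n) * IH * (min 1 q) ^ 2 ≤ (3 * (1 + n) * IH + 1) * q := by
          gcongr
          linarith
      _ = IG / 1024 := by rw [hq]; field_simp
  refine ⟨IG * τ ^ n / 4096, by positivity, ?_⟩
  intro lam s S a b u D z x hlam hs hls ha hb hbs hu hD hpos h0 heq hS hvol hx
  set f : EuclideanSpace ℝ (Fin n) → ℝ := fun y => u y ^ 2 - a - b * ‖y - z‖ ^ 2 with hf
  have hfc : ContDiff ℝ 2 f := by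
    have : ContDiff ℝ 2 fun y : EuclideanSpace ℝ (Fin n) => ‖y - z‖ ^ 2 :=
      (contDiff_id.sub contDiff_const).norm_sq ℝ
    exact ((hu.pow 2).sub contDiff_const).sub (contDiff_const.mul this)
  have hfS : ∀ y ∈ D, f y ≤ S ^ 2 := fun y hy => by
    have : 0 ≤ b * ‖y - z‖ ^ 2 := by positivity
    linarith [hS y hy]
  set w := D.indicator fun y => f y ^ 3 with hw
  have hwc : ContDiff ℝ 2 w := (contDiff_indicator_pow_three hD hfc h0).1
  have hσ : 0 < τ * s := by positivity
  have hΛ : ∀ y, -(6 * (S ^ 2) ^ 2 * (lam * S ^ 2 + n * b)) ≤ lapl n w y := by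
    intro y
    refine le_trans ?_ (lapl_indicator_pow_three_ge hD hfc h0 hpos y)
    by_cases hy : y ∈ D
    · rw [indicator_of_mem hy]
      have hl := lapl_sq_sub_ge hu a b z y
      rw [heq y hy] at hl
      have hf0 := hpos y hy
      have hf2 : f y ^ 2 ≤ (S ^ 2) ^ 2 := pow_le_pow_left₀ hf0 (hfS y hy) 2
      have hl2 : -(2 * (lam * S ^ 2 + n * b)) ≤ lapl n f y := by
        have := mul_le_mul_of_nonneg_left (hS y hy) hlam
        linarith
      have hnn : 0 ≤ 2 * (lam * S ^ 2 + n * b) := by positivity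
      calc -(6 * (S ^ 2) ^ 2 * (lam * S ^ 2 + n * b))
          = -(3 * ((S ^ 2) ^ 2 * (2 * (lam * S ^ 2 + n * b)))) := by ring
        _ ≤ -(3 * (f y ^ 2 * (2 * (lam * S ^ 2 + n * b)))) := by gcongr
        _ = 3 * f y ^ 2 * -(2 * (lam * S ^ 2 + n * b)) := by ring
        _ ≤ 3 * f y ^ 2 * lapl n f y := by gcongr
    · rw [indicator_of_notMem hy]
      have : 0 ≤ 6 * (S ^ 2) ^ 2 * (lam * S ^ 2 + n * b) := by positivity
      linarith
  have hmean := mul_integral_weightG_le hwc hΛ x hσ.le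
  have hint := integral_mul_weightG_le hD hwc.continuous (M := (S ^ 2) ^ 3) (by positivity)
    (fun y => by
      by_cases hy : y ∈ D
      · rw [hw, indicator_of_mem hy, indicator_of_mem hy]
        exact pow_le_pow_left₀ (hpos y hy) (hfS y hy) 3
      · rw [hw, indicator_of_notMem hy, indicator_of_notMem hy]) x hσ
  have hv : volume.real (D ∩ ball x (τ * s)) ≤ IG * τ ^ n / 4096 * s ^ n := by
    refine (measureReal_mono ?_ ?_).trans hvol
    · exact inter_subset_inter_right _ (ball_subset_ball (by nlinarith))
    · exact ((measure_mono inter_subset_right).trans_lt measure_ball_lt_top).ne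
  have hv2 : volume.real (D ∩ ball x (τ * s)) / (τ * s) ^ n ≤ IG / 4096 := by
    rw [div_le_iff₀ (by positivity), mul_pow]
    linarith
  have hsecond : 6 * (S ^ 2) ^ 2 * (lam * S ^ 2 + n * b) * (τ * s) ^ 2 / 2 * IH ≤
      (S ^ 2) ^ 3 * (IG / 1024) := by
    have h1 : (lam * S ^ 2 + n * b) * s ^ 2 ≤ (1 + n) * S ^ 2 := by
      have e1 := mul_le_mul_of_nonneg_right hls (sq_nonneg S)
      have e2 := mul_le_mul_of_nonneg_left hbs (Nat.cast_nonneg (α := ℝ) n)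
      linarith
    calc 6 * (S ^ 2) ^ 2 * (lam * S ^ 2 + n * b) * (τ * s) ^ 2 / 2 * IH
        = 3 * (S ^ 2) ^ 2 * τ ^ 2 * IH * ((lam * S ^ 2 + n * b) * s ^ 2) := by ring
      _ ≤ 3 * (S ^ 2) ^ 2 * τ ^ 2 * IH * ((1 + n) * S ^ 2) := by gcongr
      _ = (S ^ 2) ^ 3 * (3 * (1 + n) * IH * τ ^ 2) := by ring
      _ ≤ (S ^ 2) ^ 3 * (IG / 1024) := by gcongr
  have hwx : w x = f x ^ 3 := indicator_of_mem hx _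
  rw [hwx] at hmean
  have hfin : f x ^ 3 * IG ≤ (S ^ 2 / 8) ^ 3 * IG := by
    have h4 : 4 * (S ^ 2) ^ 3 * (volume.real (D ∩ ball x (τ * s)) / (τ * s) ^ n) ≤
        4 * (S ^ 2) ^ 3 * (IG / 4096) := by gcongr
    calc f x ^ 3 * IG ≤ 4 * (S ^ 2) ^ 3 * (IG / 4096) + (S ^ 2) ^ 3 * (IG / 1024) := by
          linarith
      _ = (S ^ 2 / 8) ^ 3 * IG := by ring
  exact le_of_pow_le_pow_left₀ (by norm_num) (by positivity) (le_of_mul_le_mul_right hfin hIGpos)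

end Decay

section Shell

lemma isOpen_superlevel {X : Type*} [TopologicalSpace X] {W : Set X} (hW : IsOpen W) {f : X → ℝ}
    (hf : Continuous f) : IsOpen {y | y ∈ W ∧ 0 < f y} :=
  hW.inter (isOpen_lt continuous_const hf)

lemma eq_zero_of_mem_frontier_superlevel {X : Type*} [TopologicalSpace X] {W : Set X}
    (hW : IsOpen W) {f : X → ℝ} (hf : Continuous f) (h : ∀ y ∈ closure W, y ∉ W → f y ≤ 0) :
    ∀ y ∈ frontier {y | y ∈ W ∧ 0 < f y}, f y = 0 := by
  intro y hy
  rw [(isOpen_superlevel hW hf).frontier_eq] at hy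
  have hcl : y ∈ closure W := closure_mono (fun z hz => hz.1) hy.1
  have hge : 0 ≤ f y := by
    have hsub : closure {y | y ∈ W ∧ 0 < f y} ⊆ {y | 0 ≤ f y} :=
      closure_minimal (fun z hz => hz.2.le) (isClosed_le continuous_const hf)
    exact hsub hy.1
  refine le_antisymm ?_ hge
  by_contra! hlt
  by_cases hyW : y ∈ W
  · exact hy.2 ⟨hyW, hlt⟩
  · exact hlt.not_ge (h y hcl hyW)

lemma mem_of_mem_closure_of_frontier {X : Type*} [TopologicalSpace X] {Ω : Set X} (hΩ : IsOpen Ω)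
    {u : X → ℝ} {K : Set X} (hfr : ∀ y ∈ frontier Ω, y ∈ K → u y = 0) {y : X}
    (hy : y ∈ closure Ω) (hK : y ∈ K) (huy : u y ≠ 0) : y ∈ Ω := by
  by_contra hn
  refine huy (hfr y ?_ hK)
  rw [hΩ.frontier_eq]
  exact ⟨hy, hn⟩

/-- If a nodal domain occupies little volume in a thin shell around the sphere of radius `t`, the
eigenfunction at least doubles from the inside to the outside of the shell. -/
lemma exists_shell_decay (n : ℕ) :
    ∃ η : ℝ, 0 < η ∧ ∀ (lam s t S : ℝ) (u : EuclideanSpace ℝ (Fin n) → ℝ)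
      (Ω : Set (EuclideanSpace ℝ (Fin n))) (z : EuclideanSpace ℝ (Fin n)),
      0 < lam → 0 < s → lam * s ^ 2 ≤ 1 → ContDiff ℝ 2 u → IsOpen Ω →
      (∀ y ∈ frontier Ω, y ∈ closedBall z (t + s) → u y = 0) →
      (∀ y ∈ Ω ∩ ball z (t + s), lapl n u y = -lam * u y) →
      (∀ y ∈ Ω ∩ ball z (t + s), |u y| ≤ S) →
      volume.real (Ω ∩ ball z (t + s)) ≤ η * (√lam)⁻¹ ^ n →
      volume.real (Ω ∩ ball z (t + s)) - volume.real (Ω ∩ ball z (t - s)) ≤ η * s ^ n →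
      ∀ x ∈ Ω ∩ ball z t, |u x| ≤ S / 2 := by
  obtain ⟨η, hη, H⟩ := exists_truncation_decay n
  refine ⟨η, hη, ?_⟩
  intro lam s t S u Ω z hlam hs hls hu hΩ hfr heq hS hvol hshell
  have huc := hu.continuous
  have hSsq : ∀ y ∈ Ω ∩ ball z (t + s), u y ^ 2 ≤ S ^ 2 := fun y hy => by
    rw [← sq_abs]
    exact pow_le_pow_left₀ (abs_nonneg _) (hS y hy) 2
  have hfinite : ∀ p q, volume (Ω ∩ ball p q) ≠ ⊤ := fun p q =>
    ((measure_mono inter_subset_right).trans_lt measure_ball_lt_top).ne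
  have hsphere : ∀ x ∈ Ω, dist x z = t → u x ^ 2 ≤ S ^ 2 / 8 := by
    intro x hx hxt
    have hsub : ball x s ⊆ ball z (t + s) := ball_subset_ball' (by linarith)
    have hcsub : closedBall x s ⊆ closedBall z (t + s) := closedBall_subset_closedBall' (by linarith)
    by_cases hux : u x = 0
    · rw [hux, zero_pow two_ne_zero]; positivity
    set b := S ^ 2 / s ^ 2 with hb
    set f : EuclideanSpace ℝ (Fin n) → ℝ := fun y => u y ^ 2 - 0 - b * ‖y - x‖ ^ 2 with hf
    have hfc : Continuous f := by fun_prop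
    have hW : IsOpen (Ω ∩ ball x s) := hΩ.inter isOpen_ball
    have hfrD := eq_zero_of_mem_frontier_superlevel hW hfc (fun y hy hyW => by
      by_contra! hpos
      have hycl : y ∈ closure Ω := closure_mono inter_subset_left hy
      have hyb : y ∈ closedBall x s :=
        closure_ball_subset_closedBall (closure_mono inter_subset_right hy)
      have huS : u y ^ 2 ≤ S ^ 2 := by
        have : closure (Ω ∩ ball x s) ⊆ {y | u y ^ 2 ≤ S ^ 2} :=
          closure_minimal (fun p hp => hSsq p ⟨hp.1, hsub hp.2⟩)
            (isClosed_le (by fun_prop) continuous_const)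
        exact this hy
      have hbn : 0 ≤ b * ‖y - x‖ ^ 2 := by positivity
      have huy : u y ≠ 0 := by
        intro h0
        simp only [hf, h0] at hpos
        linarith
      have hyΩ := mem_of_mem_closure_of_frontier hΩ hfr hycl (hcsub hyb) huy
      refine hyW ⟨hyΩ, ?_⟩
      rw [mem_closedBall, dist_eq_norm] at hyb
      rw [mem_ball, dist_eq_norm]
      refine lt_of_le_of_ne hyb fun hne => ?_
      have : b * ‖y - x‖ ^ 2 = S ^ 2 := by rw [hne, hb]; field_simp
      simp only [hf] at hpos
      linarith)
    have hshell2 : volume.real ({y | y ∈ Ω ∩ ball x s ∧ 0 < f y} ∩ ball x s) ≤ η * s ^ n := by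
      refine le_trans ?_ hshell
      have hdiff : (Ω ∩ ball z (t + s)) \ (Ω ∩ ball z (t - s)) ⊇
          {y | y ∈ Ω ∩ ball x s ∧ 0 < f y} ∩ ball x s := by
        intro y hy
        refine ⟨⟨hy.1.1.1, hsub hy.2⟩, fun h => ?_⟩
        have h1 := mem_ball.1 h.2
        have h2 := mem_ball.1 hy.2
        have h3 := dist_triangle x y z
        rw [dist_comm x y] at h3
        linarith
      have hss : Ω ∩ ball z (t - s) ⊆ Ω ∩ ball z (t + s) :=
        inter_subset_inter_right _ (ball_subset_ball (by linarith))
      rw [← measureReal_sdiff hss (hΩ.inter isOpen_ball).measurableSet (hfinite _ _)]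
      exact measureReal_mono hdiff (measure_ne_top_of_subset sdiff_subset (hfinite _ _))
    have hxD : x ∈ {y | y ∈ Ω ∩ ball x s ∧ 0 < f y} := by
      refine ⟨⟨hx, mem_ball_self hs⟩, ?_⟩
      simp only [hf, sub_self, norm_zero]
      have : 0 < u x ^ 2 := by positivity
      linarith
    have := H lam s S 0 b u {y | y ∈ Ω ∩ ball x s ∧ 0 < f y} x x hlam.le hs hls le_rfl
      (by positivity) (by rw [hb]; field_simp; exact le_rfl) hu (isOpen_superlevel hW hfc)
      (fun y hy => hy.2.le) hfrD
      (fun y hy => heq y ⟨hy.1.1, hsub hy.1.2⟩) (fun y hy => hSsq y ⟨hy.1.1, hsub hy.1.2⟩)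
      hshell2 hxD
    simpa using this
  intro x hx
  have htsub : ball z t ⊆ ball z (t + s) := ball_subset_ball (by linarith)
  have htcsub : closedBall z t ⊆ closedBall z (t + s) := closedBall_subset_closedBall (by linarith)
  have hS0 : 0 ≤ S := (abs_nonneg _).trans (hS x ⟨hx.1, htsub hx.2⟩)
  suffices hgoal : u x ^ 2 ≤ (S / 2) ^ 2 by
    rw [← sq_abs] at hgoal
    exact le_of_pow_le_pow_left₀ (by norm_num) (by positivity) hgoal
  by_cases hux : u x ^ 2 ≤ S ^ 2 / 8
  · nlinarith [sq_nonneg S]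
  rw [not_le] at hux
  set f : EuclideanSpace ℝ (Fin n) → ℝ := fun y => u y ^ 2 - S ^ 2 / 8 - 0 * ‖y - z‖ ^ 2 with hf
  have hfc : Continuous f := by fun_prop
  have hW : IsOpen (Ω ∩ ball z t) := hΩ.inter isOpen_ball
  have hfrD := eq_zero_of_mem_frontier_superlevel hW hfc (fun y hy hyW => by
    by_contra! hpos
    have hycl : y ∈ closure Ω := closure_mono inter_subset_left hy
    have hyb : y ∈ closedBall z t :=
      closure_ball_subset_closedBall (closure_mono inter_subset_right hy)
    simp only [hf, zero_mul, sub_zero] at hpos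
    have huy : u y ≠ 0 := by
      intro h0
      rw [h0] at hpos
      nlinarith [sq_nonneg S]
    have hyΩ := mem_of_mem_closure_of_frontier hΩ hfr hycl (htcsub hyb) huy
    refine hyW ⟨hyΩ, ?_⟩
    refine lt_of_le_of_ne (mem_closedBall.1 hyb) fun hne => ?_
    linarith [hsphere y hyΩ hne])
  have hsl : 0 < √lam := Real.sqrt_pos.2 hlam
  have hsubD : {y | y ∈ Ω ∩ ball z t ∧ 0 < f y} ∩ ball x (√lam)⁻¹ ⊆ Ω ∩ ball z (t + s) :=
    fun y hy => ⟨hy.1.1.1, htsub hy.1.1.2⟩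
  have hvolD := (measureReal_mono hsubD (hfinite _ _)).trans hvol
  have := H lam (√lam)⁻¹ S (S ^ 2 / 8) 0 u {y | y ∈ Ω ∩ ball z t ∧ 0 < f y} z x hlam.le
    (by positivity) (by rw [inv_pow, Real.sq_sqrt hlam.le, mul_inv_cancel₀ hlam.ne'])
    (by positivity) le_rfl (by rw [zero_mul]; positivity) hu (isOpen_superlevel hW hfc)
      (fun y hy => hy.2.le) hfrD
    (fun y hy => heq y ⟨hy.1.1, htsub hy.1.2⟩) (fun y hy => hSsq y ⟨hy.1.1, htsub hy.1.2⟩)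
    hvolD
    ⟨hx, by simp only [hf]; linarith⟩
  nlinarith [this]

end Shell

section Growth

/-- Exponential growth of an eigenfunction along a nodal domain of small volume: it gains a factor
`2 ^ (k / 2)` between the radii `ρ` and `2ρ`, cut into `k` shells. -/
lemma exists_growth (n : ℕ) :
    ∃ η : ℝ, 0 < η ∧ ∀ (lam ρ S : ℝ) (k : ℕ) (u : EuclideanSpace ℝ (Fin n) → ℝ)
      (Ω : Set (EuclideanSpace ℝ (Fin n))) (z : EuclideanSpace ℝ (Fin n)),
      0 < lam → 0 < ρ → 0 < k → lam * (ρ / (2 * k)) ^ 2 ≤ 1 → ContDiff ℝ 2 u → IsOpen Ω →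
      (∀ y ∈ frontier Ω, y ∈ closedBall z (2 * ρ) → u y = 0) →
      (∀ y ∈ Ω ∩ ball z (2 * ρ), lapl n u y = -lam * u y) →
      (∀ y ∈ Ω ∩ ball z (2 * ρ), |u y| ≤ S) →
      volume.real (Ω ∩ ball z (2 * ρ)) ≤ η * (√lam)⁻¹ ^ n →
      volume.real (Ω ∩ ball z (2 * ρ)) ≤ k / 2 * (η * (ρ / (2 * k)) ^ n) →
      ∀ x ∈ Ω ∩ ball z ρ, |u x| ≤ S * 2 ^ (-(k : ℝ) / 2) := by
  obtain ⟨η, hη, H⟩ := exists_shell_decay n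
  refine ⟨η, hη, ?_⟩
  intro lam ρ S k u Ω z hlam hρ hk hsmall hu hΩ hfr heq hS hvol hvolk
  have hk' : (0 : ℝ) < k := by exact_mod_cast hk
  set s := ρ / (2 * k) with hs
  have hs0 : 0 < s := by positivity
  have hsk : ρ + 2 * k * s = 2 * ρ := by rw [hs]; field_simp; norm_num
  set V : ℝ → ℝ := fun t => volume.real (Ω ∩ ball z t) with hV
  have hVmono : ∀ p q, p ≤ q → V p ≤ V q := fun p q hpq =>
    measureReal_mono (inter_subset_inter_right _ (ball_subset_ball hpq))
      (((measure_mono inter_subset_right).trans_lt measure_ball_lt_top).ne)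
  set e := η * s ^ n with he
  have he0 : 0 < e := by positivity
  have key : ∀ i : ℕ, i ≤ k → ∀ S : ℝ, (∀ y ∈ Ω ∩ ball z (ρ + 2 * i * s), |u y| ≤ S) →
      ∀ x ∈ Ω ∩ ball z ρ,
        |u x| ≤ S * 2 ^ (-(i : ℝ) + (V (ρ + 2 * i * s) - V ρ) / e) := by
    intro i
    induction i with
    | zero =>
      intro _ S hS x hx
      simpa using hS x (by simpa using hx)
    | succ i ih =>
      intro hik S hS x hx
      set q := ρ + 2 * i * s with hq
      have hq2 : ρ + 2 * ((i + 1 : ℕ) : ℝ) * s = (q + s) + s := by push_cast; ring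
      have hqle : (q + s) + s ≤ 2 * ρ := by
        rw [← hq2, ← hsk]
        have : ((i + 1 : ℕ) : ℝ) ≤ k := by exact_mod_cast hik
        gcongr
      have hρq : ρ ≤ q := by
        have : 0 ≤ 2 * (i : ℝ) * s := by positivity
        linarith
      rw [hq2] at hS ⊢
      have hS0 : 0 ≤ S := (abs_nonneg _).trans
        (hS x ⟨hx.1, ball_subset_ball (by linarith) hx.2⟩)
      have hVq := hVmono q ((q + s) + s) (by linarith)
      have hsubρ : ball z ((q + s) + s) ⊆ ball z (2 * ρ) := ball_subset_ball hqle
      by_cases hgood : V ((q + s) + s) - V q ≤ e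
      · have hhalf := H lam s (q + s) S u Ω z hlam hs0 hsmall hu hΩ
          (fun y hy hyb => hfr y hy (closedBall_subset_closedBall hqle hyb))
          (fun y hy => heq y ⟨hy.1, hsubρ hy.2⟩) hS ((hVmono _ _ hqle).trans hvol)
          (by simpa [hV] using hgood)
        have := ih (by omega) (S / 2)
          (fun y hy => hhalf y ⟨hy.1, ball_subset_ball (by linarith) hy.2⟩) x hx
        refine this.trans ?_
        have h2 : S / 2 * (2 : ℝ) ^ (-(i : ℝ) + (V q - V ρ) / e) =
            S * 2 ^ (-((i + 1 : ℕ) : ℝ) + (V q - V ρ) / e) := by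
          rw [show -((i + 1 : ℕ) : ℝ) + (V q - V ρ) / e =
            (-(i : ℝ) + (V q - V ρ) / e) - 1 by push_cast; ring,
            Real.rpow_sub_one (by norm_num)]
          ring
        rw [h2]
        gcongr
        norm_num
      · rw [not_le] at hgood
        have := ih (by omega) S
          (fun y hy => hS y ⟨hy.1, ball_subset_ball (by linarith) hy.2⟩) x hx
        refine this.trans ?_
        refine mul_le_mul_of_nonneg_left
          (Real.rpow_le_rpow_of_exponent_le (by norm_num) ?_) hS0
        have h1 : 1 ≤ (V ((q + s) + s) - V q) / e := by
          rw [le_div_iff₀ he0]; linarith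
        have h2 : (V ((q + s) + s) - V ρ) / e =
            (V ((q + s) + s) - V q) / e + (V q - V ρ) / e := by ring
        rw [h2]
        push_cast
        linarith
  intro x hx
  have hfin := key k le_rfl S (by rwa [hsk]) x hx
  rw [hsk] at hfin
  have hS0 : 0 ≤ S := (abs_nonneg _).trans
    (hS x ⟨hx.1, ball_subset_ball (by linarith) hx.2⟩)
  refine hfin.trans ?_
  gcongr
  · norm_num
  · have h1 : (V (2 * ρ) - V ρ) / e ≤ k / 2 := by
      rw [div_le_iff₀ he0]
      have : 0 ≤ V ρ := measureReal_nonneg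
      linarith
    linarith

lemma exists_constants (m : ℕ) {a b ε : ℝ} (ha : 0 ≤ a) (hb : 0 ≤ b) (hε : 0 < ε) :
    ∃ c' : ℝ, 0 < c' ∧ c' ≤ ε ∧ c' * (a + b * |Real.log c'|) ^ m ≤ ε := by
  have h1 := Real.tendsto_pow_mul_exp_neg_atTop_nhds_zero m
  have h2 := (h1.const_mul ((a + b) ^ m)).eventually_le_const (u := ε) (by simpa using hε)
  have h3 := (Real.tendsto_exp_neg_atTop_nhds_zero).eventually_le_const hε
  obtain ⟨L, hL2, hL3, hL1⟩ := (h2.and (h3.and (Filter.eventually_ge_atTop 1))).exists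
  refine ⟨Real.exp (-L), Real.exp_pos _, hL3, ?_⟩
  rw [Real.log_exp, abs_neg, abs_of_nonneg (by linarith)]
  refine le_trans ?_ hL2
  have h4 : a + b * L ≤ (a + b) * L := by nlinarith
  calc Real.exp (-L) * (a + b * L) ^ m ≤ Real.exp (-L) * ((a + b) * L) ^ m := by gcongr
    _ = (a + b) ^ m * (L ^ m * Real.exp (-L)) := by rw [mul_pow]; ring

lemma half_le_log {lam : ℝ} (hlam : 2 < lam) : 1 / 2 ≤ Real.log lam := by
  have := Real.log_le_log (by norm_num) hlam.le
  linarith [Real.log_two_gt_d9]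

lemma one_le_sqrt {lam : ℝ} (hlam : 2 < lam) : 1 ≤ √lam := by
  rw [Real.one_le_sqrt]; linarith

lemma log_sqrt_mul_log_le {lam : ℝ} (hlam : 2 < lam) :
    Real.log (√lam * Real.log lam) ≤ 2 * Real.log lam := by
  have hl := half_le_log hlam
  have h1 : Real.log (√lam) = Real.log lam / 2 := Real.log_sqrt (by linarith)
  have h2 := Real.log_le_sub_one_of_pos (x := Real.log lam) (by linarith)
  rw [Real.log_mul (by linarith [one_le_sqrt hlam]) (by linarith), h1]
  linarith

/-- The Remez lower bound and exponential growth with `k ≥ M√λ log λ` are incompatible. -/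
lemma growth_remez_absurd {m : ℕ} {c C c' κ M lam : ℝ} {k : ℕ} (hc : 0 < c) (hC : 0 < C)
    (hc' : 0 < c') (hκ : 0 < κ) (hlam : 2 < lam)
    (hM : 8 * (|Real.log c| + C * (|Real.log κ| + |Real.log c'| + m)) + 1 ≤ M)
    (hk : M * (√lam * Real.log lam) ≤ k)
    (h : c * (κ * (c' / (√lam * Real.log lam) ^ m)) ^ (C * √lam) ≤ 2 ^ (-(k : ℝ) / 2)) :
    False := by
  have hl := half_le_log hlam
  have hs := one_le_sqrt hlam
  set X := √lam * Real.log lam with hX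
  have hX2 : 1 / 2 ≤ X := by nlinarith
  have hX0 : 0 < X := by linarith
  have hlog := Real.log_le_log (by positivity) h
  rw [Real.log_mul (by positivity) (by positivity), Real.log_rpow (by positivity),
    Real.log_rpow (by norm_num), Real.log_mul (by positivity) (by positivity),
    Real.log_div (by positivity) (by positivity), Real.log_pow] at hlog
  have hlX := log_sqrt_mul_log_le hlam
  rw [← hX] at hlX
  have h1 := neg_abs_le (Real.log c)
  have h2 := neg_abs_le (Real.log κ)
  have h3 := neg_abs_le (Real.log c')
  set p := |Real.log c|
  set q := |Real.log κ|
  set w := |Real.log c'|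
  have hp : 0 ≤ p := abs_nonneg _
  have hq : 0 ≤ q := abs_nonneg _
  have hw : 0 ≤ w := abs_nonneg _
  have e1 : -(q + w + m * (2 * Real.log lam)) ≤
      Real.log κ + (Real.log c' - m * Real.log X) := by
    have := mul_le_mul_of_nonneg_left hlX (Nat.cast_nonneg (α := ℝ) m)
    linarith
  have e2 : q + w + m * (2 * Real.log lam) ≤ 2 * (q + w + m) * Real.log lam := by
    nlinarith
  have e3 : -(C * (2 * (q + w + m) * X)) ≤
      C * √lam * (Real.log κ + (Real.log c' - m * Real.log X)) := by
    have hCs : 0 ≤ C * √lam := by positivity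
    have := mul_le_mul_of_nonneg_left (show -(2 * (q + w + m) * Real.log lam) ≤
      Real.log κ + (Real.log c' - m * Real.log X) by linarith) hCs
    calc -(C * (2 * (q + w + m) * X)) = C * √lam * -(2 * (q + w + m) * Real.log lam) := by
          rw [hX]; ring
      _ ≤ _ := this
  have e4 : M * X / 4 ≤ k / 2 * Real.log 2 := by
    have hk0 : (0 : ℝ) ≤ k := Nat.cast_nonneg k
    nlinarith [Real.log_two_gt_d9]
  have e5 : p ≤ 2 * p * X := by nlinarith
  have e6 : (8 * (p + C * (q + w + m)) + 1) * X ≤ M * X := by gcongr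
  have e7 : k / 2 * Real.log 2 ≤ p + C * (2 * (q + w + m) * X) := by linarith
  nlinarith

end Growth

section Main

lemma biSup_abs_le {α : Type*} {E : Set α} {f : α → ℝ} {B : ℝ} (hB : 0 ≤ B)
    (h : ∀ x ∈ E, |f x| ≤ B) : ⨆ x ∈ E, |f x| ≤ B :=
  Real.iSup_le (fun x => Real.iSup_le (fun hx => h x hx) hB) hB

lemma le_biSup_abs {α : Type*} {E : Set α} {f : α → ℝ} {B : ℝ}
    (h : ∀ x ∈ E, |f x| ≤ B) {x : α} (hx : x ∈ E) : |f x| ≤ ⨆ x ∈ E, |f x| := by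
  have hB : 0 ≤ B := (abs_nonneg _).trans (h x hx)
  have hbdd : BddAbove (range fun x => ⨆ _ : x ∈ E, |f x|) :=
    ⟨B, by rintro _ ⟨y, rfl⟩; exact Real.iSup_le (fun hy => h y hy) hB⟩
  refine le_ciSup_of_le hbdd x ?_
  rw [ciSup_pos hx]

lemma frontier_connectedComponentIn_eq_zero {E : Type*} [NormedAddCommGroup E]
    [NormedSpace ℝ E] {u : E → ℝ} {U : Set E} (hU : IsOpen U) (hu : Continuous u) {x y : E}
    (hy : y ∈ frontier (connectedComponentIn {x ∈ U | u x ≠ 0} x)) (hyU : y ∈ U) : u y = 0 := by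
  by_contra hne
  have hF : IsOpen {x ∈ U | u x ≠ 0} := hU.inter (isOpen_ne_fun hu continuous_const)
  have hyF : y ∈ {x ∈ U | u x ≠ 0} := ⟨hyU, hne⟩
  obtain ⟨w, hwy, hwx⟩ := mem_closure_iff.1 (frontier_subset_closure hy) _
    (hF.connectedComponentIn (x := y)) (mem_connectedComponentIn hyF)
  have e := (connectedComponentIn_eq hwy).trans (connectedComponentIn_eq hwx).symm
  have hyx : y ∈ connectedComponentIn {x ∈ U | u x ≠ 0} x := e ▸ mem_connectedComponentIn hyF
  rw [(hF.connectedComponentIn).frontier_eq] at hy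
  exact hy.2 hyx

lemma exists_remez_constants (m : ℕ) {c C η κ ω : ℝ} (hC : 0 < C) (hη : 0 < η)
    (hω : 0 < ω) :
    ∃ c' M : ℝ, 0 < c' ∧ 1 ≤ M ∧ c' ≤ η ∧ c' * 2 ^ m ≤ ω ∧
      c' * (M + 2) ^ m * (2 * 4 ^ (m + 1)) ≤ η ∧
      8 * (|Real.log c| + C * (|Real.log κ| + |Real.log c'| + m)) + 1 ≤ M := by
  obtain ⟨c', h0, h1, h2⟩ := exists_constants m
    (a := 8 * (|Real.log c| + C * (|Real.log κ| + m)) + 3) (b := 8 * C)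
    (ε := min η (min (ω / 2 ^ m) (η / (2 * 4 ^ (m + 1)))))
    (by positivity) (by positivity) (by positivity)
  refine ⟨c', 8 * (|Real.log c| + C * (|Real.log κ| + |Real.log c'| + m)) + 1, h0, ?_,
    h1.trans (min_le_left _ _), ?_, ?_, le_rfl⟩
  · have : 0 ≤ 8 * (|Real.log c| + C * (|Real.log κ| + |Real.log c'| + m)) := by positivity
    linarith
  · rw [← le_div_iff₀ (by positivity)]
    exact h1.trans ((min_le_right _ _).trans (min_le_left _ _))
  · rw [← le_div_iff₀ (by positivity)]
    refine le_trans (le_of_eq ?_) (h2.trans ((min_le_right _ _).trans (min_le_right _ _)))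
    congr 2
    ring

/-- A lower bound on the density at small scales which passes from `ρ` to `2ρ` up to scale `R`
holds at scale `R`. -/
lemma density_of_doubling {V : ℝ → ℝ} {δ R : ℝ} {n : ℕ} (hR : 0 < R)
    (hsmall : ∃ J : ℕ, δ * (R / 2 ^ J) ^ n ≤ V (R / 2 ^ J))
    (hdbl : ∀ ρ, 0 < ρ → 2 * ρ ≤ R → δ * ρ ^ n ≤ V ρ → δ * (2 * ρ) ^ n ≤ V (2 * ρ)) :
    δ * R ^ n ≤ V R := by
  obtain ⟨J, hJ⟩ := hsmall
  induction J with
  | zero => simpa using hJ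
  | succ J ih =>
    have e : 2 * (R / 2 ^ (J + 1)) = R / 2 ^ J := by rw [pow_succ]; field_simp
    have := hdbl (R / 2 ^ (J + 1)) (by positivity)
      (by rw [e]; exact div_le_self hR.le (one_le_pow₀ (by norm_num))) hJ
    rw [e] at this
    exact ih this

lemma measureReal_ball_eq {n : ℕ} (z : EuclideanSpace ℝ (Fin n)) {ρ : ℝ}
    (hρ : 0 < ρ) :
    volume.real (ball z ρ) = ρ ^ n * volume.real (ball (0 : EuclideanSpace ℝ (Fin n)) 1) := by
  rw [measureReal_def, Measure.addHaar_ball_of_pos _ _ hρ, finrank_euclideanSpace_fin,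
    ENNReal.toReal_mul, ENNReal.toReal_ofReal (by positivity), measureReal_def]

end Main

/-- Local volume bound for nodal domains (Theorem 2, first part), assuming the
Remez-type inequality as a hypothesis. -/
theorem stmt_0 (n : ℕ) (hn : 2 ≤ n) (c C : ℝ) (hc : 0 < c) (hC : 0 < C) :
    ∃ c' : ℝ, 0 < c' ∧
      ∀ (lam r : ℝ) (x₀ : EuclideanSpace ℝ (Fin n))
        (u : EuclideanSpace ℝ (Fin n) → ℝ),
        2 < lam → 0 < r →
        ContDiff ℝ 2 u →
        (∀ x ∈ ball x₀ (2 * r), lapl n u x = -lam * u x) →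
        (∀ (y : EuclideanSpace ℝ (Fin n)) (ρ : ℝ), 0 < ρ →
          ball y ρ ⊆ ball x₀ (2 * r) →
          ∀ E : Set (EuclideanSpace ℝ (Fin n)), E ⊆ ball y ρ → MeasurableSet E →
            0 < volume E →
            (⨆ x ∈ E, |u x|) ≥
              c * (c * (volume E).toReal / (volume (ball y ρ)).toReal) ^
                  (C * Real.sqrt lam) * ⨆ x ∈ ball y ρ, |u x|) →
        ∀ Ω : Set (EuclideanSpace ℝ (Fin n)),
          (∃ x ∈ {x ∈ ball x₀ (2 * r) | u x ≠ 0},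
              Ω = connectedComponentIn {x ∈ ball x₀ (2 * r) | u x ≠ 0} x) →
          (Ω ∩ ball x₀ r).Nonempty →
          (volume Ω).toReal ≥
            c' * min (lam ^ (-(n : ℝ) / 2))
              (r ^ n / (Real.sqrt lam * Real.log lam) ^ (n - 1)) := by
  obtain ⟨m, rfl⟩ : ∃ m, n = m + 1 := ⟨n - 1, by omega⟩
  obtain ⟨η, hη, growth⟩ := exists_growth (m + 1)
  set ω := volume.real (ball (0 : EuclideanSpace ℝ (Fin (m + 1))) 1) with hω
  have hω0 : 0 < ω :=
    ENNReal.toReal_pos (measure_ball_pos volume _ one_pos).ne' measure_ball_lt_top.ne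
  set κ := c / (2 ^ (m + 1) * ω) with hκ
  have hκ0 : 0 < κ := by positivity
  obtain ⟨c', M, hc', hM1, hc'η, hc'ω, hc'M, hM⟩ :=
    exists_remez_constants m (c := c) (κ := κ) hC hη hω0
  refine ⟨c', hc', ?_⟩
  intro lam r x₀ u hlam hr hu heq remez Ω hΩ hne
  rw [Nat.add_sub_cancel]
  have hl := half_le_log hlam
  have hs := one_le_sqrt hlam
  set X := √lam * Real.log lam with hX
  have hX2 : 1 / 2 ≤ X := by nlinarith
  have hX0 : 0 < X := by linarith
  obtain ⟨k, hMk, hkM⟩ : ∃ k : ℕ, M * X ≤ k ∧ (k : ℝ) ≤ (M + 2) * X :=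
    ⟨⌈M * X⌉₊, Nat.le_ceil _, (Nat.ceil_lt_add_one (by positivity)).le.trans (by nlinarith)⟩
  have hXk : X ≤ k := le_trans (by nlinarith) hMk
  have hk0 : (0 : ℝ) < k := hX0.trans_le hXk
  obtain ⟨x, -, rfl⟩ := hΩ
  set Ω := connectedComponentIn {x ∈ ball x₀ (2 * r) | u x ≠ 0} x with hΩdef
  have hΩF : Ω ⊆ {x ∈ ball x₀ (2 * r) | u x ≠ 0} := connectedComponentIn_subset _ _
  have hΩo : IsOpen Ω :=
    (isOpen_ball.inter (isOpen_ne_fun hu.continuous continuous_const)).connectedComponentIn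
  have hΩfin : volume Ω ≠ ⊤ :=
    ((measure_mono fun y hy => (hΩF hy).1).trans_lt measure_ball_lt_top).ne
  obtain ⟨z, hzΩ, hz⟩ := hne
  by_contra hcon
  rw [ge_iff_le, not_le, ← measureReal_def] at hcon
  have hpow : lam ^ (-((m + 1 : ℕ) : ℝ) / 2) = (√lam)⁻¹ ^ (m + 1) := by
    rw [Real.sqrt_eq_rpow, ← Real.rpow_neg (by linarith), ← Real.rpow_natCast,
      ← Real.rpow_mul (by linarith)]
    congr 1
    ring
  rw [hpow] at hcon
  have hcon1 : volume.real Ω < c' * (√lam)⁻¹ ^ (m + 1) :=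
    hcon.trans_le (by gcongr; exact min_le_left _ _)
  have hcon2 : volume.real Ω < c' * (r ^ (m + 1) / X ^ m) :=
    hcon.trans_le (by gcongr; exact min_le_right _ _)
  set δ := c' / X ^ m with hδ
  have hδ0 : 0 < δ := by positivity
  set R := min r (2 * k / √lam) with hR
  have hR0 : 0 < R := by positivity
  have hRr : R ≤ r := min_le_left _ _
  have hball : closedBall z R ⊆ ball x₀ (2 * r) := by
    refine (closedBall_subset_closedBall hRr).trans (closedBall_subset_ball' ?_)
    rw [mem_ball] at hz
    linarith
  have hmono : ∀ ρ, volume.real (Ω ∩ ball z ρ) ≤ volume.real Ω := fun ρ =>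
    measureReal_mono inter_subset_left hΩfin
  have hfinal : δ * R ^ (m + 1) ≤ volume.real (Ω ∩ ball z R) := by
    refine density_of_doubling (V := fun ρ => volume.real (Ω ∩ ball z ρ)) hR0 ?_ ?_
    · obtain ⟨ε, hε, hεΩ⟩ := Metric.isOpen_iff.1 hΩo z hzΩ
      obtain ⟨J, hJ⟩ := exists_pow_lt_of_lt_one (show 0 < ε / R by positivity)
        (show (1 / 2 : ℝ) < 1 by norm_num)
      refine ⟨J, ?_⟩
      have hJε : R / 2 ^ J ≤ ε := by
        rw [lt_div_iff₀ hR0, one_div, inv_pow] at hJ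
        rw [div_eq_inv_mul]
        exact hJ.le
      rw [inter_eq_right.2 ((ball_subset_ball hJε).trans hεΩ),
        measureReal_ball_eq z (by positivity), mul_comm]
      gcongr
      rw [hδ, div_le_iff₀ (by positivity)]
      calc c' = c' * 2 ^ m * (1 / 2) ^ m := by rw [mul_assoc, ← mul_pow]; norm_num
        _ ≤ ω * X ^ m := by gcongr
    · intro ρ hρ hρR hV
      by_contra! hV2
      have hsub : closedBall z (2 * ρ) ⊆ ball x₀ (2 * r) :=
        (closedBall_subset_closedBall hρR).trans hball
      have hsub' : ball z (2 * ρ) ⊆ ball x₀ (2 * r) := ball_subset_closedBall.trans hsub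
      obtain ⟨B, hB⟩ := (isCompact_closedBall z (2 * ρ)).exists_bound_of_continuousOn
        hu.continuous.continuousOn
      have hle : ∀ y ∈ ball z (2 * ρ), |u y| ≤ ⨆ y ∈ ball z (2 * ρ), |u y| := fun y hy =>
        le_biSup_abs (fun w hw => hB w (ball_subset_closedBall hw)) hy
      have hzS := hle z (mem_ball_self (by positivity))
      have hrem := remez z (2 * ρ) (by positivity) hsub' (Ω ∩ ball z ρ)
        (inter_subset_right.trans (ball_subset_ball (by linarith)))
        (hΩo.inter isOpen_ball).measurableSet
        ((hΩo.inter isOpen_ball).measure_pos _ ⟨z, hzΩ, mem_ball_self hρ⟩)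
      set S := ⨆ y ∈ ball z (2 * ρ), |u y| with hS
      have hS0 : 0 < S := (abs_pos.2 (hΩF hzΩ).2).trans_le hzS
      have hscale : lam * (ρ / (2 * k)) ^ 2 ≤ 1 := by
        have h1 : ρ / (2 * k) ≤ (√lam)⁻¹ := by
          rw [div_le_iff₀ (by positivity), ← div_eq_inv_mul]
          have := hρR.trans (min_le_right _ _)
          linarith
        calc lam * (ρ / (2 * k)) ^ 2 ≤ lam * (√lam)⁻¹ ^ 2 := by gcongr
          _ = 1 := by
            rw [inv_pow, Real.sq_sqrt (by linarith), mul_inv_cancel₀ (by linarith)]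
      have hvol : δ * (2 * ρ) ^ (m + 1) ≤ k / 2 * (η * (ρ / (2 * k)) ^ (m + 1)) := by
        have h1 : δ * k ^ m ≤ c' * (M + 2) ^ m := by
          rw [hδ, div_mul_eq_mul_div, div_le_iff₀ (by positivity), mul_assoc, ← mul_pow]
          gcongr
        have h2 : δ * k ^ m * (2 * 4 ^ (m + 1)) ≤ η := le_trans (by gcongr) hc'M
        calc δ * (2 * ρ) ^ (m + 1)
            = k / 2 * (δ * k ^ m * (2 * 4 ^ (m + 1)) * (ρ / (2 * k)) ^ (m + 1)) := by
              rw [show (4 : ℝ) = 2 * 2 by norm_num, div_pow, mul_pow, mul_pow, mul_pow]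
              field_simp
              ring
          _ ≤ _ := by gcongr
      have hgrow := growth lam ρ S k u Ω z (by linarith) hρ (by exact_mod_cast hk0) hscale hu
        hΩo (fun y hy hyb => frontier_connectedComponentIn_eq_zero isOpen_ball hu.continuous hy
          (hsub hyb)) (fun y hy => heq y (hsub' hy.2)) (fun y hy => hle y hy.2)
        ((hmono _).trans (hcon1.le.trans (by gcongr))) (hV2.le.trans hvol)
      have hsup := hrem.le.trans (biSup_abs_le (by positivity) hgrow)
      rw [mul_comm S, ← measureReal_def, ← measureReal_def] at hsup
      refine growth_remez_absurd hc hC hc' hκ0 hlam hM hMk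
        (le_trans ?_ (le_of_mul_le_mul_right hsup hS0))
      gcongr
      rw [measureReal_ball_eq z (by positivity), le_div_iff₀ (by positivity)]
      calc κ * (c' / X ^ m) * ((2 * ρ) ^ (m + 1) * ω) = c * (δ * ρ ^ (m + 1)) := by
            rw [hκ, hδ]; field_simp; ring
        _ ≤ _ := by gcongr
  have hle := hfinal.trans (hmono R)
  rcases min_choice r (2 * k / √lam) with h | h
  · refine hcon2.not_ge (le_trans (le_of_eq ?_) hle)
    rw [hR, h, hδ]
    ring
  · refine hcon1.not_ge (le_trans ?_ hle)
    rw [hR, h, hδ, div_pow, inv_pow, div_mul_div_comm, ← div_eq_mul_inv,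
      div_le_div_iff₀ (by positivity) (by positivity)]
    have h1 : X ^ m ≤ (2 * k) ^ (m + 1) := by
      rw [pow_succ, ← mul_one (X ^ m)]
      gcongr
      · linarith
      · linarith
    calc c' * (X ^ m * √lam ^ (m + 1)) ≤ c' * ((2 * k) ^ (m + 1) * √lam ^ (m + 1)) := by gcongr
      _ = _ := by ring
end

section
/- For every dimension n ≥ 1 there exists a constant c₀ > 0 (depending only on n) with the following property. Let λ > 0, let 0 < ρ ≤ 1/√λ, let x ∈ ℝⁿ, and let u be a λ-eigenfunction on an open neighborhood of the closed ball of center x and radius ρ with u(x) ≠ 0. Let Ω be the connected component of the set {y ∈ B(x,ρ) : u(y) ≠ 0} containing x. If |Ω| ≤ c₀·|B(x,ρ)|, then |u(x)| ≤ (1/10)·sup_Ω |u|. -/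
open MeasureTheory Metric Set

/-- The truncated paraboloid `max (1 - ‖z‖²) 0`. -/
noncomputable def paraboloid {E : Type*} [Norm E] (z : E) : ℝ := max (1 - ‖z‖ ^ 2) 0

section Paraboloid

variable {E : Type*} [NormedAddCommGroup E]

lemma paraboloid_nonneg (z : E) : 0 ≤ paraboloid z := le_max_right _ _

lemma paraboloid_le_one (z : E) : paraboloid z ≤ 1 :=
  max_le (by nlinarith [sq_nonneg ‖z‖]) zero_le_one

lemma paraboloid_eq_zero {z : E} (hz : 1 ≤ ‖z‖) : paraboloid z = 0 :=
  max_eq_right (by nlinarith)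

lemma continuous_paraboloid : Continuous (paraboloid : E → ℝ) := by
  unfold paraboloid
  fun_prop

lemma hasCompactSupport_paraboloid [ProperSpace E] :
    HasCompactSupport (paraboloid : E → ℝ) :=
  HasCompactSupport.intro (isCompact_closedBall 0 1) fun z hz => paraboloid_eq_zero (by
    simp only [mem_closedBall, dist_zero_right, not_le] at hz
    exact hz.le)

lemma tsupport_paraboloid_sq_subset :
    tsupport (fun z : E => paraboloid z ^ 2) ⊆ closedBall 0 1 := by
  refine closure_minimal (fun z hz => ?_) isClosed_closedBall
  by_contra h
  simp only [mem_closedBall, dist_zero_right, not_le] at h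
  exact hz (by simp [paraboloid_eq_zero h.le])

lemma integrable_paraboloid [ProperSpace E] [MeasurableSpace E] [BorelSpace E]
    (μ : Measure E) [IsFiniteMeasureOnCompacts μ] : Integrable (paraboloid : E → ℝ) μ :=
  continuous_paraboloid.integrable_of_hasCompactSupport hasCompactSupport_paraboloid

lemma integrable_paraboloid_sq [ProperSpace E] [MeasurableSpace E] [BorelSpace E]
    (μ : Measure E) [IsFiniteMeasureOnCompacts μ] :
    Integrable (fun z : E => paraboloid z ^ 2) μ := by
  simp_rw [pow_two]
  exact (continuous_paraboloid.mul continuous_paraboloid).integrable_of_hasCompactSupport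
    hasCompactSupport_paraboloid.mul_left

lemma integral_paraboloid_pos [ProperSpace E] [MeasurableSpace E] [BorelSpace E]
    (μ : Measure E) [IsFiniteMeasureOnCompacts μ] [μ.IsOpenPosMeasure] :
    0 < ∫ z, paraboloid z ∂μ :=
  continuous_paraboloid.integral_pos_of_hasCompactSupport_nonneg_nonzero
    hasCompactSupport_paraboloid paraboloid_nonneg (x := 0) (by simp [paraboloid])

end Paraboloid

lemma hasDerivAt_max_zero_sq (s : ℝ) :
    HasDerivAt (fun t : ℝ => max t 0 ^ 2) (2 * max s 0) s := by
  rcases lt_trichotomy s 0 with hs | rfl | hs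
  · rw [max_eq_right hs.le, mul_zero]
    refine (hasDerivAt_const s (0 : ℝ)).congr_of_eventuallyEq ?_
    filter_upwards [Iio_mem_nhds hs] with t ht
    simp [max_eq_right (le_of_lt (mem_Iio.1 ht))]
  · rw [max_self, mul_zero]
    refine HasDerivAt.of_isLittleO ?_
    have h : (fun t : ℝ => t ^ 2) =o[nhds 0] fun t : ℝ => t := by
      simpa using Asymptotics.isLittleO_pow_pow (𝕜 := ℝ) (one_lt_two)
    simp only [max_self, smul_zero, sub_zero, ne_eq, OfNat.ofNat_ne_zero, not_false_eq_true,
      zero_pow]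
    refine Asymptotics.IsBigO.trans_isLittleO (Asymptotics.IsBigO.of_bound 1 ?_) h
    refine Filter.Eventually.of_forall fun t => ?_
    rw [one_mul, norm_pow, norm_pow]
    gcongr
    rcases le_total t 0 with ht | ht <;> simp [ht]
  · rw [max_eq_left hs.le]
    have h := hasDerivAt_pow 2 s
    refine HasDerivAt.congr_of_eventuallyEq (by simpa using h) ?_
    filter_upwards [Ioi_mem_nhds hs] with t ht
    simp [max_eq_left (le_of_lt (mem_Ioi.1 ht))]

lemma hasFDerivAt_paraboloid_sq {E : Type*} [NormedAddCommGroup E] [InnerProductSpace ℝ E]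
    (z : E) :
    HasFDerivAt (fun z : E => paraboloid z ^ 2) ((-4 * paraboloid z) • innerSL ℝ z) z := by
  have h := (hasDerivAt_max_zero_sq (1 - ‖z‖ ^ 2)).comp_hasFDerivAt z
    ((hasStrictFDerivAt_norm_sq z).hasFDerivAt.const_sub 1)
  refine h.congr_fderiv ?_
  ext w
  simp only [paraboloid, smul_neg, neg_apply, smul_apply, smul_eq_mul,
    nsmul_eq_mul]
  simp
  ring

lemma HasFDerivAt.indicator_of_frontier {E F : Type*} [NormedAddCommGroup E] [NormedSpace ℝ E]
    [NormedAddCommGroup F] [NormedSpace ℝ F] {S : Set E} (hS : IsOpen S) {h : E → F}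
    {h' : E → E →L[ℝ] F} {y : E} (hd : HasFDerivAt h (h' y) y)
    (hfr : y ∈ frontier S → h y = 0 ∧ h' y = 0) :
    HasFDerivAt (S.indicator h) (S.indicator h' y) y := by
  by_cases hy : y ∈ S
  · rw [indicator_of_mem hy]
    refine hd.congr_of_eventuallyEq ?_
    filter_upwards [hS.mem_nhds hy] with z hz using indicator_of_mem hz h
  rw [indicator_of_notMem hy]
  by_cases hc : y ∈ closure S
  · obtain ⟨h0, h0'⟩ := hfr (by rw [hS.frontier_eq]; exact ⟨hc, hy⟩)
    rw [h0'] at hd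
    refine HasFDerivAt.of_isLittleO ?_
    have ho := hd.isLittleO
    simp only [h0, sub_zero, zero_apply] at ho
    simp only [indicator_of_notMem hy, sub_zero, zero_apply]
    exact (Asymptotics.isBigO_of_le _ fun z => norm_indicator_le_norm_self h z).trans_isLittleO ho
  · refine (hasFDerivAt_const (0 : F) y).congr_of_eventuallyEq ?_
    filter_upwards [isClosed_closure.isOpen_compl.mem_nhds hc] with z hz
    exact indicator_of_notMem (fun hzS => hz (subset_closure hzS)) h

lemma Continuous.exists_norm_indicator_le {E F : Type*} [PseudoMetricSpace E] [ProperSpace E]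
    [NormedAddCommGroup F] {S : Set E} (hS : Bornology.IsBounded S) {h : E → F}
    (hh : Continuous h) : ∃ C, ∀ y, ‖S.indicator h y‖ ≤ C := by
  obtain ⟨C, hC⟩ := hS.isCompact_closure.exists_bound_of_continuousOn hh.continuousOn
  refine ⟨max C 0, fun y => ?_⟩
  by_cases hy : y ∈ S
  · rw [indicator_of_mem hy]
    exact (hC y (subset_closure hy)).trans (le_max_left _ _)
  · simp [hy]

lemma integrable_indicator_comp_mul {E : Type*} [NormedAddCommGroup E] [NormedSpace ℝ E]
    [ProperSpace E] [MeasurableSpace E] [BorelSpace E] {μ : Measure E} {S : Set E}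
    (hS : IsOpen S) (hb : Bornology.IsBounded S) {h : E → ℝ} (hh : Continuous h) (x : E) (r : ℝ)
    {g : E → ℝ} (hg : Integrable g μ) :
    Integrable (fun z => S.indicator h (x + r • z) * g z) μ := by
  obtain ⟨C, hC⟩ := hh.exists_norm_indicator_le hb
  refine hg.bdd_mul (c := C) ?_ (Filter.Eventually.of_forall fun z => hC _)
  have hm : Measurable fun z : E => x + r • z :=
    (by fun_prop : Continuous fun z : E => x + r • z).measurable
  exact ((hh.measurable.indicator hS.measurableSet).comp hm).aestronglyMeasurable

lemma mem_ball_of_abs_lt {E : Type*} [NormedAddCommGroup E] [NormedSpace ℝ E] {x z : E}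
    {r ρ : ℝ} (hr : |r| < ρ) (hz : ‖z‖ ≤ 1) : x + r • z ∈ ball x ρ := by
  rw [mem_ball, dist_eq_norm, add_sub_cancel_left, norm_smul, Real.norm_eq_abs]
  nlinarith [abs_nonneg r]

section MeanValue

variable {n : ℕ}

local notation "E" => EuclideanSpace ℝ (Fin n)

lemma integral_partial_mul_paraboloid {S : Set E} {x : E} {ρ r : ℝ} (hS : IsOpen S)
    (hb : Bornology.IsBounded S) {p : E → ℝ} (hp : ContDiff ℝ 1 p)
    (hfr : ∀ y ∈ ball x ρ, y ∈ frontier S → p y = 0 ∧ fderiv ℝ p y = 0)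
    (hr : |r| < ρ) (j : Fin n) :
    ∫ z, S.indicator p (x + r • z) * (z j * paraboloid z) =
      r / 4 * ∫ z, S.indicator (fun y => fderiv ℝ p y (EuclideanSpace.single j 1)) (x + r • z) *
        paraboloid z ^ 2 := by
  have hψi : Integrable fun z : E => paraboloid z ^ 2 := integrable_paraboloid_sq volume
  have hφi : Integrable fun z : E => z j * paraboloid z :=
    (Continuous.mul (by fun_prop) continuous_paraboloid).integrable_of_hasCompactSupport
      hasCompactSupport_paraboloid.mul_left
  have hψ' : ∀ z : E, fderiv ℝ (fun z : E => paraboloid z ^ 2) z (EuclideanSpace.single j 1) =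
      -4 * (z j * paraboloid z) := fun z => by
    rw [(hasFDerivAt_paraboloid_sq z).fderiv]
    simp [EuclideanSpace.inner_single_right]
    ring
  have hP : ∀ z : E, ‖z‖ ≤ 1 → HasFDerivAt (fun z : E => S.indicator p (x + r • z))
      (r • S.indicator (fderiv ℝ p) (x + r • z)) z := fun z hz => by
    have h1 := HasFDerivAt.indicator_of_frontier hS
      (hp.differentiable one_ne_zero (x + r • z)).hasFDerivAt (hfr _ (mem_ball_of_abs_lt hr hz))
    have h2 := h1.comp z (((hasFDerivAt_id z).const_smul r).const_add x)
    refine h2.congr_fderiv ?_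
    ext w
    simp
  have hq : Continuous fun y => fderiv ℝ p y (EuclideanSpace.single j 1) :=
    (hp.continuous_fderiv one_ne_zero).clm_apply continuous_const
  have hP' : ∀ z : E, ‖z‖ ≤ 1 → fderiv ℝ (fun z : E => S.indicator p (x + r • z)) z
      (EuclideanSpace.single j 1) = r * S.indicator
        (fun y => fderiv ℝ p y (EuclideanSpace.single j 1)) (x + r • z) := fun z hz => by
    rw [(hP z hz).fderiv]
    by_cases h : x + r • z ∈ S <;> simp [h]
  have hP'' : ∀ z : E, fderiv ℝ (fun z : E => S.indicator p (x + r • z)) z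
      (EuclideanSpace.single j 1) * paraboloid z ^ 2 = r * (S.indicator
        (fun y => fderiv ℝ p y (EuclideanSpace.single j 1)) (x + r • z) * paraboloid z ^ 2) :=
      fun z => by
    rcases le_total ‖z‖ 1 with hz | hz
    · rw [hP' z hz, mul_assoc]
    · simp [paraboloid_eq_zero hz]
  have key := integral_mul_fderiv_eq_neg_fderiv_mul_of_integrable (μ := volume)
    (f := fun z : E => S.indicator p (x + r • z)) (g := fun z : E => paraboloid z ^ 2)
    (v := EuclideanSpace.single j 1)
    (by
      simp_rw [hP'']
      exact (integrable_indicator_comp_mul hS hb hq x r hψi).const_mul r)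
    (by
      simp_rw [hψ']
      exact integrable_indicator_comp_mul hS hb hp.continuous x r (hφi.const_mul _))
    (integrable_indicator_comp_mul hS hb hp.continuous x r hψi)
    (fun z hz => (hP z (by simpa using tsupport_paraboloid_sq_subset hz)).differentiableAt)
    (fun z _ => (hasFDerivAt_paraboloid_sq z).differentiableAt)
  simp_rw [hP'', hψ', mul_left_comm _ (-4 : ℝ)] at key
  rw [integral_const_mul, integral_const_mul] at key
  linarith

lemma hasDerivAt_integral_indicator_mul_paraboloid {S : Set E} {x : E} {ρ r : ℝ} (hS : IsOpen S)
    (hb : Bornology.IsBounded S) {h : E → ℝ} (hh : ContDiff ℝ 2 h)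
    (hfr : ∀ y ∈ ball x ρ, y ∈ frontier S →
      h y = 0 ∧ fderiv ℝ h y = 0 ∧ fderiv ℝ (fderiv ℝ h) y = 0)
    (hr : |r| < ρ) :
    HasDerivAt (fun r : ℝ => ∫ z, S.indicator h (x + r • z) * paraboloid z)
      (r / 4 * ∫ z, S.indicator (lapl n h) (x + r • z) * paraboloid z ^ 2) r := by
  have hD : ContDiff ℝ 1 (fderiv ℝ h) := hh.fderiv_right (by norm_num)
  have hpj : ∀ j : Fin n, ContDiff ℝ 1 fun y => fderiv ℝ h y (EuclideanSpace.single j 1) :=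
    fun j => hD.clm_apply contDiff_const
  have hpj' : ∀ (j : Fin n) (y w : E),
      fderiv ℝ (fun y => fderiv ℝ h y (EuclideanSpace.single j 1)) y w =
        fderiv ℝ (fderiv ℝ h) y w (EuclideanSpace.single j 1) := fun j y w => by
    rw [fderiv_clm_apply (hD.differentiable one_ne_zero y) (differentiableAt_const _)]
    simp
  obtain ⟨C, hC⟩ := hD.continuous.exists_norm_indicator_le hb
  have hcoord : ∀ y w : E, S.indicator (fderiv ℝ h) y w = ∑ j : Fin n,
      S.indicator (fun y => fderiv ℝ h y (EuclideanSpace.single j 1)) y * w j := fun y w => by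
    by_cases hy : y ∈ S
    · simp only [indicator_of_mem hy]
      conv_lhs => rw [← (EuclideanSpace.basisFun (Fin n) ℝ).sum_repr w]
      simp [mul_comm]
    · simp [hy]
  have hzint : ∀ j : Fin n, Integrable fun z : E => z j * paraboloid z := fun j =>
    (Continuous.mul (by fun_prop) continuous_paraboloid).integrable_of_hasCompactSupport
      hasCompactSupport_paraboloid.mul_left
  have hint : ∀ j : Fin n, Integrable fun z : E => S.indicator
      (fun y => fderiv ℝ h y (EuclideanSpace.single j 1)) (x + r • z) * (z j * paraboloid z) :=
    fun j => integrable_indicator_comp_mul hS hb (hpj j).continuous x r (hzint j)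
  have hF' : ∀ z : E, S.indicator (fderiv ℝ h) (x + r • z) z * paraboloid z = ∑ j : Fin n,
      S.indicator (fun y => fderiv ℝ h y (EuclideanSpace.single j 1)) (x + r • z) *
        (z j * paraboloid z) := fun z => by
    rw [hcoord, Finset.sum_mul]
    simp_rw [mul_assoc]
  have hval : ∫ z, S.indicator (fderiv ℝ h) (x + r • z) z * paraboloid z =
      r / 4 * ∫ z, S.indicator (lapl n h) (x + r • z) * paraboloid z ^ 2 := by
    simp_rw [hF']
    rw [integral_finsetSum _ fun j _ => hint j]
    have hl : ∀ z : E, S.indicator (lapl n h) (x + r • z) * paraboloid z ^ 2 = ∑ j : Fin n,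
        S.indicator (fun y => fderiv ℝ (fun y => fderiv ℝ h y (EuclideanSpace.single j 1)) y
          (EuclideanSpace.single j 1)) (x + r • z) * paraboloid z ^ 2 := fun z => by
      rw [← Finset.sum_mul]
      by_cases hy : x + r • z ∈ S <;> simp [hy, lapl]
    simp_rw [hl]
    rw [integral_finsetSum _ fun j _ => integrable_indicator_comp_mul hS hb
      (((hpj j).continuous_fderiv one_ne_zero).clm_apply continuous_const) x r
      (integrable_paraboloid_sq volume), Finset.mul_sum]
    refine Finset.sum_congr rfl fun j _ => ?_
    refine integral_partial_mul_paraboloid hS hb (hpj j) (fun y hy hyf => ?_) hr j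
    obtain ⟨-, h1, h2⟩ := hfr y hy hyf
    refine ⟨by simp [h1], ?_⟩
    ext w
    simp [hpj', h2]
  rw [← hval]
  have hC0 : 0 ≤ C := (norm_nonneg _).trans (hC 0)
  refine (hasDerivAt_integral_of_dominated_loc_of_deriv_le (bound := fun z => C * paraboloid z)
    (F' := fun r z => S.indicator (fderiv ℝ h) (x + r • z) z * paraboloid z)
    (s := {r : ℝ | |r| < ρ}) ((isOpen_lt continuous_abs continuous_const).mem_nhds hr)
    (Filter.Eventually.of_forall fun t => (integrable_indicator_comp_mul hS hb hh.continuous x t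
      (integrable_paraboloid volume)).aestronglyMeasurable)
    (integrable_indicator_comp_mul hS hb hh.continuous x r (integrable_paraboloid volume))
    ?_ (Filter.Eventually.of_forall fun z t ht => ?_)
    ((integrable_paraboloid volume).const_mul C)
    (Filter.Eventually.of_forall fun z t ht => ?_)).2
  · simp_rw [hF']
    exact (integrable_finsetSum _ fun j _ => hint j).aestronglyMeasurable
  · rcases le_total 1 ‖z‖ with hz | hz
    · simp [paraboloid_eq_zero hz]
    · rw [norm_mul, Real.norm_of_nonneg (paraboloid_nonneg z)]
      refine mul_le_mul_of_nonneg_right ?_ (paraboloid_nonneg z)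
      refine (ContinuousLinearMap.le_opNorm _ _).trans ?_
      nlinarith [hC (x + t • z), norm_nonneg z]
  · rcases le_total 1 ‖z‖ with hz | hz
    · simpa [paraboloid_eq_zero hz] using hasDerivAt_const t (0 : ℝ)
    · have h1 := HasFDerivAt.indicator_of_frontier hS
        (hh.differentiable two_ne_zero (x + t • z)).hasFDerivAt fun hy =>
          ⟨(hfr _ (mem_ball_of_abs_lt ht hz) hy).1, (hfr _ (mem_ball_of_abs_lt ht hz) hy).2.1⟩
      have h2 := h1.comp_hasDerivAt t (((hasDerivAt_id t).smul_const z).const_add x)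
      simpa using h2.mul_const (paraboloid z)

lemma indicator_mul_integral_paraboloid_le {S : Set E} {x : E} {ρ R L : ℝ} (hS : IsOpen S)
    (hb : Bornology.IsBounded S) {h : E → ℝ} (hh : ContDiff ℝ 2 h)
    (hfr : ∀ y ∈ ball x ρ, y ∈ frontier S →
      h y = 0 ∧ fderiv ℝ h y = 0 ∧ fderiv ℝ (fderiv ℝ h) y = 0)
    (hL : 0 ≤ L) (hlapl : ∀ y ∈ S, -L ≤ lapl n h y) (hR : 0 ≤ R) (hRρ : R < ρ) :
    S.indicator h x * ∫ z : E, paraboloid z ≤ (∫ z, S.indicator h (x + R • z) * paraboloid z) +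
      L * R ^ 2 / 8 * ∫ z : E, paraboloid z ^ 2 := by
  have hd : ∀ t ∈ Icc 0 R, HasDerivAt (fun r : ℝ =>
      (∫ z, S.indicator h (x + r • z) * paraboloid z) +
        L * r ^ 2 / 8 * ∫ z : E, paraboloid z ^ 2)
      ((t / 4 * ∫ z, S.indicator (lapl n h) (x + t • z) * paraboloid z ^ 2) +
        L * (2 * t) / 8 * ∫ z : E, paraboloid z ^ 2) t := fun t ht => by
    have h1 := hasDerivAt_integral_indicator_mul_paraboloid hS hb hh hfr
      (r := t) (by rw [abs_of_nonneg ht.1]; exact ht.2.trans_lt hRρ)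
    have h2 := (((hasDerivAt_pow 2 t).const_mul L).div_const 8).mul_const
      (∫ z : E, paraboloid z ^ 2)
    exact (h1.add h2).congr_deriv (by norm_num)
  have hmono := monotoneOn_of_deriv_nonneg (convex_Icc 0 R)
    (fun t ht => (hd t ht).continuousAt.continuousWithinAt)
    (fun t ht => (hd t (interior_subset ht)).differentiableAt.differentiableWithinAt)
    (fun t ht => by
      have ht := interior_subset ht
      rw [(hd t ht).deriv]
      have hge : -L * ∫ z : E, paraboloid z ^ 2 ≤
          ∫ z, S.indicator (lapl n h) (x + t • z) * paraboloid z ^ 2 := by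
        have hlc : Continuous (lapl n h) := continuous_finsetSum _ fun j _ =>
          ((((hh.fderiv_right (m := 1) (by norm_num)).clm_apply
            contDiff_const).continuous_fderiv one_ne_zero).clm_apply continuous_const)
        rw [← integral_const_mul]
        refine integral_mono ((integrable_paraboloid_sq volume).const_mul _)
          (integrable_indicator_comp_mul hS hb hlc x t (integrable_paraboloid_sq volume))
          fun z => mul_le_mul_of_nonneg_right ?_ (sq_nonneg _)
        by_cases hz : x + t • z ∈ S
        · simpa [hz] using hlapl _ hz
        · simpa [hz] using hL
      nlinarith [mul_le_mul_of_nonneg_left hge ht.1])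
  have := hmono (left_mem_Icc.2 hR) (right_mem_Icc.2 hR) hR
  simpa [integral_const_mul] using this

lemma integral_indicator_mul_paraboloid_le {S : Set E} {x : E} {R K : ℝ} (hS : IsOpen S)
    (hb : Bornology.IsBounded S) {h : E → ℝ} (hh : Continuous h) (hK : ∀ y ∈ S, h y ≤ K)
    (hK0 : 0 ≤ K) (hR : 0 < R) :
    ∫ z, S.indicator h (x + R • z) * paraboloid z ≤ K * ((R ^ n)⁻¹ * (volume S).toReal) := by
  have hi : Integrable (S.indicator fun _ : E => (1 : ℝ)) :=
    (integrable_indicator_iff hS.measurableSet).2 (integrableOn_const hb.measure_lt_top.ne)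
  have hval : ∫ z : E, S.indicator (fun _ : E => (1 : ℝ)) (x + R • z) =
      (R ^ n)⁻¹ * (volume S).toReal := by
    rw [Measure.integral_comp_smul volume
        (fun w : E => S.indicator (fun _ : E => (1 : ℝ)) (x + w)) R,
      integral_add_left_eq_self, integral_indicator_const _ hS.measurableSet,
      finrank_euclideanSpace_fin, abs_of_pos (by positivity)]
    simp [Measure.real]
  rw [← hval, ← integral_const_mul]
  refine integral_mono
    (integrable_indicator_comp_mul hS hb hh x R (integrable_paraboloid volume))
    (((hi.comp_add_left x).comp_smul hR.ne').const_mul K) fun z => ?_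
  by_cases hz : x + R • z ∈ S
  · simp only [indicator_of_mem hz, mul_one]
    nlinarith [hK _ hz, paraboloid_nonneg z, paraboloid_le_one z]
  · simp [hz]

lemma fderiv_pow_four {u : E → ℝ} (hu : Differentiable ℝ u) :
    fderiv ℝ (fun y => u y ^ 4) = fun y => (4 * u y ^ 3) • fderiv ℝ u y := by
  ext1 y
  rw [((hu y).hasFDerivAt.pow 4).fderiv]
  norm_num

lemma hasFDerivAt_fderiv_pow_four {u : E → ℝ} (hu : ContDiff ℝ 2 u) (y : E) :
    HasFDerivAt (fderiv ℝ fun y => u y ^ 4) ((4 * u y ^ 3) • fderiv ℝ (fderiv ℝ u) y +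
      ((12 * u y ^ 2) • fderiv ℝ u y).smulRight (fderiv ℝ u y)) y := by
  rw [fderiv_pow_four (hu.differentiable two_ne_zero)]
  have hD : ContDiff ℝ 1 (fderiv ℝ u) := hu.fderiv_right (by norm_num)
  have h1 := ((hu.differentiable two_ne_zero y).hasFDerivAt.pow 3).const_mul 4
  refine (h1.smul (hD.differentiable one_ne_zero y).hasFDerivAt).congr_fderiv ?_
  ext v w
  simp only [add_apply, smul_apply, ContinuousLinearMap.smulRight_apply, smul_eq_mul,
    nsmul_eq_mul]
  push_cast
  ring

lemma lapl_pow_four {u : E → ℝ} (hu : ContDiff ℝ 2 u) (y : E) :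
    lapl n (fun y => u y ^ 4) y = 4 * u y ^ 3 * lapl n u y +
      12 * u y ^ 2 * ∑ j : Fin n, fderiv ℝ u y (EuclideanSpace.single j 1) ^ 2 := by
  have hD : ContDiff ℝ 1 (fderiv ℝ u) := hu.fderiv_right (by norm_num)
  simp only [lapl, Finset.mul_sum, ← Finset.sum_add_distrib]
  refine Finset.sum_congr rfl fun j _ => ?_
  rw [fderiv_clm_apply (hasFDerivAt_fderiv_pow_four hu y).differentiableAt
      (differentiableAt_const _),
    fderiv_clm_apply (hD.differentiable one_ne_zero y) (differentiableAt_const _),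
    (hasFDerivAt_fderiv_pow_four hu y).fderiv]
  simp
  ring

lemma eq_zero_of_mem_frontier_connectedComponentIn {X : Type*} [TopologicalSpace X]
    [LocallyConnectedSpace X] {F : Set X} (hF : IsOpen F) {x y : X}
    (hy : y ∈ frontier (connectedComponentIn F x)) : y ∉ F := by
  intro hyF
  rw [hF.connectedComponentIn.frontier_eq] at hy
  obtain ⟨z, hz, hz'⟩ := mem_closure_iff.1 hy.1 _ hF.connectedComponentIn
    (mem_connectedComponentIn hyF)
  refine hy.2 ?_
  rw [connectedComponentIn_eq hz', ← connectedComponentIn_eq hz]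
  exact mem_connectedComponentIn hyF

end MeanValue

/-- Weak maximum principle for eigenfunctions on a narrow nodal domain (Corollary 2.2). -/
theorem stmt_3 (n : ℕ) (hn : 1 ≤ n) :
    ∃ c₀ : ℝ, 0 < c₀ ∧
      ∀ (lam ρ : ℝ) (x : EuclideanSpace ℝ (Fin n))
        (u : EuclideanSpace ℝ (Fin n) → ℝ) (U : Set (EuclideanSpace ℝ (Fin n))),
        0 < lam → 0 < ρ → ρ ≤ 1 / Real.sqrt lam →
        IsOpen U → closedBall x ρ ⊆ U →
        ContDiff ℝ 2 u →
        (∀ y ∈ U, lapl n u y = -lam * u y) →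
        u x ≠ 0 →
        (volume (connectedComponentIn {y ∈ ball x ρ | u y ≠ 0} x)).toReal ≤
            c₀ * (volume (ball x ρ)).toReal →
        |u x| ≤ (1 / 10) *
          ⨆ y ∈ connectedComponentIn {y ∈ ball x ρ | u y ≠ 0} x, |u y| := by
  set A := ∫ z : EuclideanSpace ℝ (Fin n), paraboloid z
  set B := ∫ z : EuclideanSpace ℝ (Fin n), paraboloid z ^ 2
  set V := (volume (ball (0 : EuclideanSpace ℝ (Fin n)) 1)).toReal
  have hA : 0 < A := integral_paraboloid_pos volume
  have hB : 0 ≤ B := integral_nonneg fun z => sq_nonneg _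
  have hV : 0 < V := ENNReal.toReal_pos (measure_ball_pos _ _ one_pos).ne' measure_ball_lt_top.ne
  set ε := A / (2 * A + 10000 * B)
  have hε : 0 < ε := by positivity
  have hε1 : ε < 1 := (div_lt_one (by positivity)).2 (by linarith)
  have hεB : 10000 * (ε * B) ≤ A := by
    have : ε * (2 * A + 10000 * B) = A := div_mul_cancel₀ _ (by positivity)
    nlinarith [mul_pos hε hA]
  refine ⟨A * ε ^ n / (20000 * V), by positivity, ?_⟩
  intro lam ρ x u U hlam hρ hρl hU hball hu heig hux hvol
  have hN : IsOpen {y ∈ ball x ρ | u y ≠ 0} :=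
    isOpen_ball.inter (hu.continuous.isOpen_preimage _ isOpen_compl_singleton)
  set N := {y ∈ ball x ρ | u y ≠ 0}
  set S := connectedComponentIn N x
  have hS : IsOpen S := hN.connectedComponentIn
  have hSN : S ⊆ N := connectedComponentIn_subset N x
  have hxS : x ∈ S := mem_connectedComponentIn ⟨mem_ball_self hρ, hux⟩
  have hSb : Bornology.IsBounded S := isBounded_ball.subset fun y hy => (hSN hy).1
  set M := ⨆ y ∈ S, |u y|
  have hM : ∀ y ∈ S, |u y| ≤ M := fun y hy => by
    obtain ⟨C, hC⟩ := hu.continuous.exists_norm_indicator_le hSb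
    have hC0 : 0 ≤ C := (norm_nonneg _).trans (hC x)
    refine le_ciSup_of_le ⟨C, ?_⟩ y (by simp [hy])
    rintro _ ⟨z, rfl⟩
    exact Real.iSup_le (fun hz => by simpa [hz] using hC z) hC0
  have hM0 : 0 ≤ M := (abs_nonneg _).trans (hM x hxS)
  have hM4 : ∀ y ∈ S, u y ^ 4 ≤ M ^ 4 := fun y hy => by
    rw [← (by decide : Even 4).pow_abs]
    exact pow_le_pow_left₀ (abs_nonneg _) (hM y hy) 4
  have hlamρ : lam * ρ ^ 2 ≤ 1 := by
    rw [le_div_iff₀ (Real.sqrt_pos.2 hlam)] at hρl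
    have h1 : (ρ * √lam) ^ 2 ≤ 1 := pow_le_one₀ (by positivity) hρl
    rw [mul_pow, Real.sq_sqrt hlam.le] at h1
    linarith
  have hfr : ∀ y ∈ ball x ρ, y ∈ frontier S → u y = 0 := fun y hy hyf => by
    by_contra h
    exact eq_zero_of_mem_frontier_connectedComponentIn hN hyf ⟨hy, h⟩
  have hmean := indicator_mul_integral_paraboloid_le (x := x) (L := 4 * lam * M ^ 4) (R := ε * ρ)
    hS hSb
    (hu.pow 4) (fun y hy hyf => ⟨by simp [hfr y hy hyf],
      by simp [fderiv_pow_four (hu.differentiable two_ne_zero), hfr y hy hyf],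
      by simp [(hasFDerivAt_fderiv_pow_four hu y).fderiv, hfr y hy hyf]⟩)
    (by positivity) (fun y hy => by
      rw [lapl_pow_four hu, heig y (hball (ball_subset_closedBall (hSN hy).1))]
      have h1 : 0 ≤ 12 * u y ^ 2 *
        ∑ j : Fin n, fderiv ℝ u y (EuclideanSpace.single j 1) ^ 2 := by positivity
      nlinarith [mul_le_mul_of_nonneg_left (hM4 y hy) hlam.le])
    (by positivity) (by nlinarith : ε * ρ < ρ)
  have hup := integral_indicator_mul_paraboloid_le (x := x) hS hSb (hu.pow 4).continuous hM4
    (by positivity) (by positivity : 0 < ε * ρ)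
  rw [indicator_of_mem hxS] at hmean
  have hvol' : ((ε * ρ) ^ n)⁻¹ * (volume S).toReal ≤ A / 20000 := by
    rw [Measure.addHaar_ball_of_pos _ _ hρ, finrank_euclideanSpace_fin, ENNReal.toReal_mul,
      ENNReal.toReal_ofReal (by positivity)] at hvol
    calc _ ≤ ((ε * ρ) ^ n)⁻¹ * (A * ε ^ n / (20000 * V) * (ρ ^ n * V)) := by gcongr
      _ = A / 20000 := by
        rw [mul_pow]
        field_simp
  have hsecond : 4 * lam * M ^ 4 * (ε * ρ) ^ 2 / 8 * B ≤ M ^ 4 * (A / 20000) := by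
    have h1 : ε * (ε * B) ≤ ε * B := mul_le_of_le_one_left (by positivity) hε1.le
    have h2 : lam * ρ ^ 2 * (ε * (ε * B)) ≤ ε * (ε * B) :=
      mul_le_of_le_one_left (by positivity) hlamρ
    calc _ = M ^ 4 * (lam * ρ ^ 2 * (ε * (ε * B)) / 2) := by ring
      _ ≤ _ := mul_le_mul_of_nonneg_left (by linarith) (by positivity)
  have h4 : u x ^ 4 * A ≤ (1 / 10 * M) ^ 4 * A := by
    have := mul_le_mul_of_nonneg_left hvol' (by positivity : 0 ≤ M ^ 4)
    calc _ ≤ M ^ 4 * (A / 20000) + M ^ 4 * (A / 20000) := by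
          exact hmean.trans (add_le_add (hup.trans this) hsecond)
      _ = _ := by ring
  have h5 := le_of_mul_le_mul_right h4 hA
  rw [← (by decide : Even 4).pow_abs] at h5
  exact le_of_pow_le_pow_left₀ (by norm_num) (by positivity) h5
end
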